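/- arXiv:1704.07035 — 2 statements merged into one kernel-verified Lean document; each statement's English description precedes it below -/
import Mathlib

section
/- Main theorem: the partition functions of the Deguchi–Martin model are given explicitly by W_{M,N}(u₁,…,u_N|v₁,…,v_M|x₁,…,x_N|a₁₂) = ∏_{1≤j<k≤N} ([1 + u_k − u_j]/[1]) · E_{M,N}(u₁,…,u_N|v₁,…,v_M|x₁,…,x_N|a₁₂), i.e. W_{M,N}(u₁,…,u_N|v₁,…,v_M|x₁,…,x_N|a₁₂) = ∏_{1≤j<k≤N} ([1+u_k−u_j]/[1]) · ∏_{k=1}^N ∏_{j=x^M_k}^{x^M_{k+1}−2} ([a₁₂+j+N]/[a₁₂+j+N−k]) · Σ_{σ∈S_N} ( ∏_{1≤j<k≤N} [1]/[u_{σ(j)}−u_{σ(k)}] · ∏_{j=1}^N ∏_{k=x_j+1}^M [u_{σ(j)}−v_k]/[1] · ∏_{j=1}^N [−u_{σ(j)}+v_{x_j}+a₁₂+x_j+N−2]/[a₁₂+x_j+N−2] · ∏_{j=1}^N ∏_{k=1}^{x_j−1} [1+u_{σ(j)}−v_k]/[1] ). -/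
open Complex

noncomputable section

/-- The half period magnitude `K₁` for elliptic nome `q`. -/
def Kone (q : ℝ) : ℝ :=
  Real.pi / 2 * ∏' n : ℕ,
    ((1 + q ^ (2 * n + 1)) / (1 - q ^ (2 * n + 1)) *
      ((1 - q ^ (2 * n + 2)) / (1 + q ^ (2 * n + 2)))) ^ 2

/-- The half period magnitude `K₂` for elliptic nome `q`. -/
def Ktwo (q : ℝ) : ℝ := -(Kone q / Real.pi) * Real.log q

/-- The elliptic theta function `H`. -/
def theta (q : ℝ) (u : ℂ) : ℂ :=
  2 * (q : ℂ) ^ (1 / 4 : ℂ) * Complex.sin (Real.pi * u / (2 * (Kone q : ℂ))) *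
    ∏' n : ℕ,
      ((1 - 2 * (q : ℂ) ^ (2 * n + 2) * Complex.cos (Real.pi * u / (Kone q : ℂ)) +
          (q : ℂ) ^ (4 * n + 4)) * (1 - (q : ℂ) ^ (2 * n + 2)))

/-- The bracket `[u] = H(λu)`. -/
def brak (q : ℝ) (lam : ℂ) (u : ℂ) : ℂ := theta q (lam * u)

/-- Unit vector ê₁. -/
def e1 : ℤ × ℤ := (1, 0)

/-- Unit vector ê₂. -/
def e2 : ℤ × ℤ := (0, 1)

/-- The scalar `a₁₂ = a₁ + a₂ + ω₁₂` attached to a state vector. -/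
def aSc (ω12 : ℂ) (a : ℤ × ℤ) : ℂ := (a.1 : ℂ) + (a.2 : ℂ) + ω12

/-- The face weights of the Deguchi-Martin model. -/
def faceW (q : ℝ) (lam ω12 : ℂ) (a b c d : ℤ × ℤ) (u v : ℂ) : ℂ :=
  if b = a + e1 ∧ c = a + e1 ∧ d = a + e1 + e1 then
    brak q lam (1 + (u - v)) / brak q lam 1
  else if b = a + e2 ∧ c = a + e2 ∧ d = a + e2 + e2 then
    brak q lam (1 - (u - v)) / brak q lam 1
  else if b = a + e2 ∧ c = a + e1 ∧ d = a + e1 + e2 then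
    brak q lam (u - v) * brak q lam (aSc ω12 a - 1) / (brak q lam 1 * brak q lam (aSc ω12 a))
  else if b = a + e1 ∧ c = a + e2 ∧ d = a + e1 + e2 then
    brak q lam (u - v) * brak q lam (-aSc ω12 a - 1) / (brak q lam 1 * brak q lam (-aSc ω12 a))
  else if b = a + e1 ∧ c = a + e1 ∧ d = a + e1 + e2 then
    brak q lam (aSc ω12 a - (u - v)) / brak q lam (aSc ω12 a)
  else if b = a + e2 ∧ c = a + e2 ∧ d = a + e1 + e2 then
    brak q lam (-aSc ω12 a - (u - v)) / brak q lam (-aSc ω12 a)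
  else 0

/-- Number of the integers `x₁ < ⋯ < x_N` that are `≤ k`. -/
def btmCount (N : ℕ) (x : ℕ → ℕ) (k : ℕ) : ℕ :=
  ((Finset.Icc 1 N).filter fun j => x j ≤ k).card

open scoped Classical in
/-- The partition function `W_{M,N}(u₁,…,u_N|v₁,…,v_M|x₁,…,x_N|a₁₂)` of the
Deguchi-Martin model: the sum over all state-vector configurations of the
`N`-row, `M`-column lattice with the prescribed boundary of the product of all
`M·N` face weights. -/
def partW (q : ℝ) (lam ω12 : ℂ) (M N : ℕ) (u v : ℕ → ℂ) (x : ℕ → ℕ)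
    (a : ℤ × ℤ) : ℂ :=
  ∑' s : Fin (N + 1) × Fin (M + 1) → ℤ × ℤ,
    if (∀ k : Fin (M + 1), s (0, k) = a + ((k : ℕ) : ℤ) • e1) ∧
       (∀ i : Fin (N + 1), s (i, 0) = a + ((i : ℕ) : ℤ) • e1) ∧
       (∀ i : Fin (N + 1), s (i, Fin.last M) = a + (M : ℤ) • e1 + ((i : ℕ) : ℤ) • e2) ∧
       (∀ k : Fin (M + 1), s (Fin.last N, k) =
          a + ((N : ℤ) + ((k : ℕ) : ℤ) - (btmCount N x (k : ℕ) : ℤ)) • e1 +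
            (btmCount N x (k : ℕ) : ℤ) • e2)
    then
      ∏ i : Fin N, ∏ k : Fin M,
        faceW q lam ω12 (s (i.castSucc, k.castSucc)) (s (i.castSucc, k.succ))
          (s (i.succ, k.castSucc)) (s (i.succ, k.succ)) (u (N - (i : ℕ))) (v ((k : ℕ) + 1))
    else 0

/-- `x^M_k`: equals `x_k` for `k = 1,…,N` and `M+1` for `k = N+1`. -/
def xM (M N : ℕ) (x : ℕ → ℕ) (k : ℕ) : ℕ := if k = N + 1 then M + 1 else x k

/-- The elliptic Schur-type symmetric function `E_{M,N}`. -/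
def ellE (q : ℝ) (lam : ℂ) (M N : ℕ) (u v : ℕ → ℂ) (x : ℕ → ℕ) (a12 : ℂ) : ℂ :=
  (∏ k ∈ Finset.Icc 1 N, ∏ j ∈ Finset.Icc (xM M N x k) (xM M N x (k + 1) - 2),
      brak q lam (a12 + (j : ℂ) + (N : ℂ)) / brak q lam (a12 + (j : ℂ) + (N : ℂ) - (k : ℂ))) *
  ∑ σ : Equiv.Perm (Fin N),
    (∏ j : Fin N, ∏ k : Fin N,
        if (j : ℕ) < (k : ℕ) then
          brak q lam 1 / brak q lam (u ((σ j : ℕ) + 1) - u ((σ k : ℕ) + 1))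
        else 1) *
    (∏ j : Fin N, ∏ k ∈ Finset.Icc (x ((j : ℕ) + 1) + 1) M,
        brak q lam (u ((σ j : ℕ) + 1) - v k) / brak q lam 1) *
    (∏ j : Fin N,
        brak q lam (-u ((σ j : ℕ) + 1) + v (x ((j : ℕ) + 1)) + a12 +
            (x ((j : ℕ) + 1) : ℂ) + (N : ℂ) - 2) /
          brak q lam (a12 + (x ((j : ℕ) + 1) : ℂ) + (N : ℂ) - 2)) *
    (∏ j : Fin N, ∏ k ∈ Finset.Icc 1 (x ((j : ℕ) + 1) - 1),
        brak q lam (1 + u ((σ j : ℕ) + 1) - v k) / brak q lam 1)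

/-- `G_{M,N}`: the product of the elliptic factors and `E_{M,N}`. -/
def ellG (q : ℝ) (lam : ℂ) (M N : ℕ) (u v : ℕ → ℂ) (x : ℕ → ℕ) (a12 : ℂ) : ℂ :=
  (∏ j : Fin N, ∏ k : Fin N,
      if (j : ℕ) < (k : ℕ) then
        brak q lam (1 + u ((k : ℕ) + 1) - u ((j : ℕ) + 1)) / brak q lam 1
      else 1) *
  ellE q lam M N u v x a12


section
open Complex Filter Topology

/-- Gaussian binomials. -/
noncomputable def gbin (p : ℂ) : ℕ → ℕ → ℂ
  | _, 0 => 1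
  | 0, _ + 1 => 0
  | m + 1, k + 1 => p ^ (k + 1) * gbin p m (k + 1) + gbin p m k

lemma gbin_zero_right (p : ℂ) (m : ℕ) : gbin p m 0 = 1 := by cases m <;> rfl

lemma gbin_of_lt (p : ℂ) : ∀ m k : ℕ, m < k → gbin p m k = 0
  | 0, k + 1, _ => rfl
  | m + 1, k + 1, h => by
    rw [gbin, gbin_of_lt p m (k + 1) (by omega), gbin_of_lt p m k (by omega)]; ring

/-- The finite q-Pochhammer symbol. -/
noncomputable def qpoc (p : ℂ) (n : ℕ) : ℂ := ∏ i ∈ Finset.range n, (1 - p ^ (i + 1))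

lemma qpoc_succ (p : ℂ) (n : ℕ) : qpoc p (n + 1) = qpoc p n * (1 - p ^ (n + 1)) :=
  Finset.prod_range_succ _ _

lemma qpoc_zero (p : ℂ) : qpoc p 0 = 1 := rfl

lemma gbin_mul (p : ℂ) : ∀ s k l : ℕ, k + l = s → gbin p s k * (qpoc p k * qpoc p l) = qpoc p s := by
  intro s
  induction s with
  | zero => intro k l h; obtain ⟨rfl, rfl⟩ : k = 0 ∧ l = 0 := by omega
            simp [gbin, qpoc]
  | succ s ih =>
    intro k l h
    cases k with
    | zero => obtain rfl : l = s + 1 := by omega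
              simp [gbin, qpoc_zero]
    | succ k =>
      rw [gbin]
      cases l with
      | zero =>
        obtain rfl : k = s := by omega
        rw [gbin_of_lt p k (k + 1) (by omega)]
        have := ih k 0 (by omega)
        rw [qpoc_succ]; linear_combination (1 - p ^ (k + 1)) * this
      | succ l =>
        have h1 := ih (k + 1) l (by omega)
        have h2 := ih k (l + 1) (by omega)
        have hs : s = k + l + 1 := by omega
        rw [qpoc_succ] at h1 h2
        rw [qpoc_succ, qpoc_succ, qpoc_succ]
        have e : p ^ (s + 1) = p ^ (k + 1) * p ^ (l + 1) := by rw [← pow_add]; congr 1; omega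
        rw [e]
        linear_combination (p ^ (k + 1)) * (1 - p ^ (l + 1)) * h1 + (1 - p ^ (k + 1)) * h2

lemma gauss_binom (p : ℂ) (m : ℕ) : ∀ x : ℂ, ∏ j ∈ Finset.range m, (1 + x * p ^ j) =
    ∑ k ∈ Finset.range (m + 1), gbin p m k * p ^ (k.choose 2) * x ^ k := by
  induction m with
  | zero => intro x; simp [gbin]
  | succ m ih =>
    intro x
    rw [Finset.prod_range_succ', Finset.sum_range_succ']
    have h := ih (x * p)
    have h' : ∏ k ∈ Finset.range m, (1 + x * p ^ (k + 1)) = ∏ j ∈ Finset.range m, (1 + x * p * p ^ j) :=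
      Finset.prod_congr rfl fun k _ => by ring
    rw [h', h]
    have e1 : ∑ k ∈ Finset.range (m + 1), gbin p (m + 1) (k + 1) * p ^ ((k + 1).choose 2) * x ^ (k + 1)
       = ∑ k ∈ Finset.range (m + 1), gbin p m (k + 1) * p ^ ((k + 1).choose 2) * (x * p) ^ (k + 1)
        + x * ∑ k ∈ Finset.range (m + 1), gbin p m k * p ^ (k.choose 2) * (x * p) ^ k := by
      rw [Finset.mul_sum, ← Finset.sum_add_distrib]
      refine Finset.sum_congr rfl fun k _ => ?_
      have : (k + 1).choose 2 = k.choose 2 + k := by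
        rw [Nat.choose_succ_succ' k 1, Nat.choose_one_right, add_comm]
      rw [gbin, this]; ring
    rw [e1]
    have e2 : ∑ k ∈ Finset.range (m + 1), gbin p m (k + 1) * p ^ ((k + 1).choose 2) * (x * p) ^ (k + 1)
      + 1 = ∑ k ∈ Finset.range (m + 1), gbin p m k * p ^ (k.choose 2) * (x * p) ^ k := by
      have := Finset.sum_range_succ' (fun k => gbin p m k * p ^ (k.choose 2) * (x * p) ^ k) (m + 1)
      rw [Finset.sum_range_succ, gbin_of_lt p m (m + 1) (by omega)] at this
      simp only [gbin_zero_right] at this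
      rw [zero_mul, zero_mul, add_zero] at this
      rw [this]; simp
    simp only [gbin_zero_right]
    simp only [Nat.choose_zero_succ, pow_zero]
    linear_combination -e2

lemma finite_triple (η ζ : ℂ) (n : ℕ) :
    ∏ k ∈ Finset.range n, ((1 + exp ζ * exp (2 * η) ^ k) * (1 + exp (2 * η) ^ (k + 1) * exp (-ζ))) =
    ∑ k ∈ Finset.range (2 * n + 1), gbin (exp (2 * η)) (2 * n) k *
      exp (η * (((k : ℂ) - n) ^ 2 - ((k : ℂ) - n)) + ((k : ℂ) - n) * ζ) := by
  have h := gauss_binom (exp (2 * η)) (2 * n) (exp (ζ - 2 * n * η))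
  rw [two_mul n, Finset.prod_range_add, ← two_mul n] at h
  rw [← Finset.prod_range_reflect (fun x => 1 + exp (ζ - 2 * n * η) * exp (2 * η) ^ x)] at h
  have e1 : ∏ j ∈ Finset.range n, (1 + exp (ζ - 2 * n * η) * exp (2 * η) ^ (n - 1 - j))
      = exp (n * ζ - n * (n + 1) * η) * ∏ j ∈ Finset.range n, (1 + exp (2 * η) ^ (j + 1) * exp (-ζ)) := by
    have : exp (n * ζ - n * (n + 1) * η) = ∏ j ∈ Finset.range n, exp (ζ - 2 * (j + 1) * η) := by
      rw [← Complex.exp_sum]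
      congr 1
      clear h
      induction n with
      | zero => simp
      | succ n ih => rw [Finset.sum_range_succ, ← ih]; push_cast; ring
    rw [this, ← Finset.prod_mul_distrib]
    refine Finset.prod_congr rfl fun j hj => ?_
    have hj' := Finset.mem_range.1 hj
    rw [mul_add, ← Complex.exp_nat_mul, ← Complex.exp_nat_mul, ← Complex.exp_add, mul_one,
      ← Complex.exp_add, ← Complex.exp_add, add_comm]
    have : ((n - 1 - j : ℕ) : ℂ) = n - 1 - j := by
      rw [Nat.sub_sub, Nat.cast_sub (by omega)]; push_cast; ring
    rw [this]
    congr 1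
    · congr 1; ring
    · symm; rw [Complex.exp_eq_one_iff]; exact ⟨0, by push_cast; ring⟩
  have e2 : ∏ x ∈ Finset.range n, (1 + exp (ζ - 2 * n * η) * exp (2 * η) ^ (n + x))
     = ∏ x ∈ Finset.range n, (1 + exp ζ * exp (2 * η) ^ x) := by
    refine Finset.prod_congr rfl fun j hj => ?_
    rw [pow_add, ← mul_assoc, ← Complex.exp_nat_mul (2 * η) n, ← Complex.exp_add]
    congr 4; ring
  rw [e1, e2] at h
  rw [Finset.prod_mul_distrib]
  have h3 : exp (n * ζ - n * (n + 1) * η) ≠ 0 := Complex.exp_ne_zero _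
  apply mul_left_cancel₀ h3
  rw [Finset.mul_sum]
  rw [show ∀ a b c : ℂ, a * (b * c) = a * c * b by intros; ring, h]
  refine Finset.sum_congr rfl fun k _ => ?_
  rw [← Complex.exp_nat_mul, ← Complex.exp_nat_mul, mul_assoc, ← Complex.exp_add, mul_left_comm,
    mul_left_comm (exp (n * ζ - n * (n + 1) * η)), ← Complex.exp_add, mul_left_comm, Nat.cast_choose_two]
  congr 2
  ring

end

section
open Complex Filter Topology

lemma qpoc_tendsto (p : ℂ) (hp : ‖p‖ < 1) : ∃ L : ℂ, L ≠ 0 ∧ Tendsto (qpoc p) atTop (𝓝 L) := by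
  have hs : Summable fun i : ℕ => ‖-p ^ (i + 1)‖ := by
    simp only [norm_neg, norm_pow]
    exact (summable_geometric_of_lt_one (norm_nonneg _) hp).comp_injective (add_left_injective 1)
  refine ⟨∏' i : ℕ, (1 + -p ^ (i + 1)), tprod_one_add_ne_zero_of_summable ?_ hs, ?_⟩
  · intro i h
    have : p ^ (i + 1) = 1 := by linear_combination -h
    have h2 : ‖p‖ ^ (i + 1) = 1 := by rw [← norm_pow, this, norm_one]
    have := pow_lt_one₀ (norm_nonneg p) hp (Nat.succ_ne_zero i)
    exact absurd h2 this.ne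
  · have := (multipliable_one_add_of_summable hs).tendsto_prod_tprod_nat
    refine this.congr fun n => ?_
    simp [qpoc, sub_eq_add_neg]

lemma qpoc_ne_zero (p : ℂ) (hp : ‖p‖ < 1) (n : ℕ) : qpoc p n ≠ 0 := by
  refine Finset.prod_ne_zero_iff.2 fun i _ h => ?_
  have : p ^ (i + 1) = 1 := by linear_combination -h
  have h2 : ‖p‖ ^ (i + 1) = 1 := by rw [← norm_pow, this, norm_one]
  have := pow_lt_one₀ (norm_nonneg p) hp (Nat.succ_ne_zero i)
  exact absurd h2 this.ne

lemma tendsto_norm_bdd {f : ℕ → ℂ} {L : ℂ} (h : Tendsto f atTop (𝓝 L)) : ∃ C : ℝ, ∀ n, ‖f n‖ ≤ C := by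
  obtain ⟨C, hC⟩ := h.norm.bddAbove_range
  exact ⟨C, fun n => hC ⟨n, rfl⟩⟩

theorem triple_tendsto (z τ : ℂ) (hτ : 0 < τ.im) :
    Tendsto (fun n : ℕ => (∏ k ∈ Finset.range n,
      ((1 + exp (2 * Real.pi * I * z + Real.pi * I * τ) * exp (2 * (Real.pi * I * τ)) ^ k) *
       (1 + exp (2 * (Real.pi * I * τ)) ^ (k + 1) * exp (-(2 * Real.pi * I * z + Real.pi * I * τ))))) *
      qpoc (exp (2 * (Real.pi * I * τ))) n) atTop (𝓝 (jacobiTheta₂ z τ)) := by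
  simp only [finite_triple]
  set p := exp (2 * (Real.pi * I * τ)) with hpdef
  have hp : ‖p‖ < 1 := by
    rw [hpdef, Complex.norm_exp]
    have : (2 * (Real.pi * I * τ)).re = - (2 * Real.pi * τ.im) := by simp [Complex.mul_re]; ring
    rw [this, Real.exp_lt_one_iff]
    have := Real.pi_pos
    nlinarith [mul_pos this hτ]
  obtain ⟨L, hL0, hL⟩ := qpoc_tendsto p hp
  obtain ⟨C, hC⟩ := tendsto_norm_bdd hL
  obtain ⟨D, hD⟩ := tendsto_norm_bdd (hL.inv₀ hL0)
  have hC0 : 0 ≤ C := (norm_nonneg _).trans (hC 0)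
  have hD0 : 0 ≤ D := (norm_nonneg _).trans (hD 0)
  let c : ℕ → ℤ → ℂ := fun n l => if l.natAbs ≤ n then
    qpoc p n * (qpoc p (2 * n) * ((qpoc p (n + l).toNat)⁻¹ * (qpoc p (n - l).toNat)⁻¹)) else 0
  have hc_bd : ∀ n l, ‖c n l‖ ≤ C * (C * (D * D)) := by
    intro n l
    simp only [c]
    split_ifs
    · rw [norm_mul, norm_mul, norm_mul]
      gcongr
      · exact hC _
      · exact hC _
      · exact hD _
      · exact hD _
    · rw [norm_zero]; positivity
  have hc_lim : ∀ l, Tendsto (fun n => c n l) atTop (𝓝 1) := by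
    intro l
    have e : L * (L * (L⁻¹ * L⁻¹)) = 1 := by field_simp
    rw [← e]
    have t1 : Tendsto (fun n : ℕ => ((n : ℤ) + l).toNat) atTop atTop :=
      tendsto_atTop.2 fun b => (eventually_ge_atTop (b + l.natAbs)).mono fun n hn => by omega
    have t2 : Tendsto (fun n : ℕ => ((n : ℤ) - l).toNat) atTop atTop :=
      tendsto_atTop.2 fun b => (eventually_ge_atTop (b + l.natAbs)).mono fun n hn => by omega
    have t3 : Tendsto (fun n : ℕ => 2 * n) atTop atTop :=
      tendsto_atTop.2 fun b => (eventually_ge_atTop b).mono fun n hn => by omega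
    have := hL.mul ((hL.comp t3).mul (((hL.comp t1).inv₀ hL0).mul ((hL.comp t2).inv₀ hL0)))
    refine this.congr' ((eventually_ge_atTop l.natAbs).mono fun n hn => ?_)
    simp only [c, if_pos hn, Function.comp]
  have key : Tendsto (fun n : ℕ => ∑' l : ℤ, c n l * jacobiTheta₂_term l z τ) atTop
      (𝓝 (∑' l : ℤ, 1 * jacobiTheta₂_term l z τ)) := by
    refine tendsto_tsum_of_dominated_convergence
      (bound := fun l => C * (C * (D * D)) * ‖jacobiTheta₂_term l z τ‖) ?_ ?_ ?_
    · exact (((summable_jacobiTheta₂_term_iff z τ).2 hτ).norm).mul_left _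
    · intro l; exact (hc_lim l).mul_const _
    · refine Eventually.of_forall fun n l => ?_
      rw [norm_mul]
      exact mul_le_mul_of_nonneg_right (hc_bd n l) (norm_nonneg _)
  simp only [one_mul] at key
  refine key.congr fun n => ?_
  have hinj : Function.Injective (fun k : ℕ => (k : ℤ) - n) := fun a b h => by
    have : (a : ℤ) - n = b - n := h
    omega
  rw [tsum_eq_sum (s := (Finset.range (2 * n + 1)).image (fun k : ℕ => (k : ℤ) - n)),
    Finset.sum_image (fun a _ b _ h => hinj h), Finset.sum_mul]
  · refine Finset.sum_congr rfl fun k hk => ?_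
    have hk' := Finset.mem_range.1 hk
    have h1 : ((n : ℤ) + ((k : ℤ) - n)).toNat = k := by omega
    have h2 : ((n : ℤ) - ((k : ℤ) - n)).toNat = 2 * n - k := by omega
    simp only [c]
    rw [if_pos (by omega), h1, h2]
    have hg := gbin_mul p (2 * n) k (2 * n - k) (by omega)
    have n1 := qpoc_ne_zero p hp k
    have n2 := qpoc_ne_zero p hp (2 * n - k)
    rw [← hg]
    have : jacobiTheta₂_term ((k : ℤ) - n) z τ = exp (Real.pi * I * τ * (((k : ℂ) - n) ^ 2 - ((k : ℂ) - n)) +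
       ((k : ℂ) - n) * (2 * Real.pi * I * z + Real.pi * I * τ)) := by
      rw [jacobiTheta₂_term]; push_cast; congr 1; ring
    rw [this]
    field_simp
  · intro l hl
    simp only [c]
    rw [if_neg, zero_mul]
    intro h
    apply hl
    rw [Finset.mem_image]
    exact ⟨(l + n).toNat, Finset.mem_range.2 (by omega), by change (((l + n).toNat : ℤ)) - n = l; omega⟩

end

section
open Complex Filter Topology

lemma hasSum_congr_aux {ι : Type*} {f g : ι → ℂ} {s : ℂ} (h : HasSum f s) (e : g = f) : HasSum g s := e ▸ h

lemma jt_mul (a b τ : ℂ) (hτ : 0 < τ.im) : jacobiTheta₂ a τ * jacobiTheta₂ b τ =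
    jacobiTheta₂ (a + b) (2 * τ) * jacobiTheta₂ (a - b) (2 * τ) +
    exp (2 * Real.pi * I * a + Real.pi * I * τ) *
      (jacobiTheta₂ (a + b + τ) (2 * τ) * jacobiTheta₂ (a - b + τ) (2 * τ)) := by
  have h2 : 0 < (2 * τ).im := by simpa using hτ
  have H : ∀ {τ : ℂ}, 0 < τ.im → ∀ x y : ℂ, HasSum (fun w : ℤ × ℤ => jacobiTheta₂_term w.1 x τ * jacobiTheta₂_term w.2 y τ)
      (jacobiTheta₂ x τ * jacobiTheta₂ y τ) := by
    intro τ hτ x y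
    have s1 := hasSum_jacobiTheta₂_term x hτ
    have s2 := hasSum_jacobiTheta₂_term y hτ
    have hs : Summable (fun w : ℤ × ℤ => jacobiTheta₂_term w.1 x τ * jacobiTheta₂_term w.2 y τ) :=
      summable_mul_of_summable_norm (f := fun n : ℤ => jacobiTheta₂_term n x τ)
        (g := fun n : ℤ => jacobiTheta₂_term n y τ) s1.summable.norm s2.summable.norm
    exact HasSum.mul (f := fun n : ℤ => jacobiTheta₂_term n x τ)
        (g := fun n : ℤ => jacobiTheta₂_term n y τ) s1 s2 hs
  let e : (ℤ × ℤ) ⊕ (ℤ × ℤ) → ℤ × ℤ :=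
    Sum.elim (fun w => (w.1 + w.2, w.1 - w.2)) (fun w => (w.1 + w.2 + 1, w.1 - w.2))
  have he : Function.Bijective e := by
    constructor
    · rintro (⟨k, j⟩ | ⟨k, j⟩) (⟨k', j'⟩ | ⟨k', j'⟩) h <;>
      · simp only [e, Sum.elim_inl, Sum.elim_inr, Prod.mk.injEq] at h
        simp only [Sum.inl.injEq, Sum.inr.injEq, Prod.mk.injEq, reduceCtorEq]
        omega
    · rintro ⟨l, m⟩
      rcases Int.emod_two_eq_zero_or_one (l + m) with h | h
      · exact ⟨Sum.inl ((l + m) / 2, (l - m) / 2), by simp only [e, Sum.elim_inl, Prod.mk.injEq]; omega⟩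
      · exact ⟨Sum.inr ((l + m - 1) / 2, (l - m - 1) / 2), by simp only [e, Sum.elim_inr, Prod.mk.injEq]; omega⟩
  have hL := ((Equiv.ofBijective e he).hasSum_iff).2 (H hτ a b)
  refine hL.unique (HasSum.sum ?_ ?_)
  · convert H h2 (a + b) (a - b) using 1
    funext ⟨k, j⟩
    simp only [Function.comp, Equiv.ofBijective_apply, e, Sum.elim_inl, jacobiTheta₂_term, ← Complex.exp_add]
    congr 1; push_cast; ring
  · refine hasSum_congr_aux ((H h2 (a + b + τ) (a - b + τ)).mul_left (exp (2 * Real.pi * I * a + Real.pi * I * τ))) ?_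
    funext ⟨k, j⟩
    simp only [Function.comp, Equiv.ofBijective_apply, e, Sum.elim_inr, jacobiTheta₂_term, ← Complex.exp_add]
    congr 1; push_cast; ring

lemma theta_eq (q : ℝ) (hq0 : 0 < q) (hq1 : q < 1) (w φ τ : ℂ)
    (hφ : φ = Real.pi * w / (2 * (Kone q : ℂ))) (hτ : Real.pi * I * τ = Real.log q) (hτ0 : 0 < τ.im) :
    theta q w = (q : ℂ) ^ (1 / 4 : ℂ) * I *
      (exp (-(I * φ)) * jacobiTheta₂ (φ / Real.pi + (1 / 2 - τ / 2)) τ) := by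
  have hpi : (Real.pi : ℂ) ≠ 0 := by exact_mod_cast Real.pi_ne_zero
  have key := triple_tendsto (φ / Real.pi + (1 / 2 - τ / 2)) τ hτ0
  have hζ : 2 * Real.pi * I * (φ / Real.pi + (1 / 2 - τ / 2)) + Real.pi * I * τ = 2 * I * φ + Real.pi * I := by
    field_simp; ring
  have hz : exp (2 * I * φ + Real.pi * I) = - exp (2 * I * φ) := by
    rw [Complex.exp_add, Complex.exp_pi_mul_I]; ring
  have hz' : exp (-(2 * I * φ + Real.pi * I)) = - exp (-(2 * I * φ)) := by
    rw [Complex.exp_neg, hz, Complex.exp_neg, inv_neg]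
  have hp : exp (2 * (Real.pi * I * τ)) = (q : ℂ) ^ 2 := by
    rw [hτ]
    have : exp ((Real.log q : ℝ) : ℂ) = q := by rw [← Complex.ofReal_exp, Real.exp_log hq0]
    rw [show (2 : ℂ) * (Real.log q : ℝ) = ((2 : ℕ) : ℂ) * (Real.log q : ℝ) by norm_num, Complex.exp_nat_mul, this]
  rw [hζ, hz, hz', hp] at key
  set Z := exp (2 * I * φ) with hZ
  have hZ0 : Z ≠ 0 := Complex.exp_ne_zero _
  have hZi : exp (-(2 * I * φ)) = Z⁻¹ := Complex.exp_neg _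
  rw [hZi] at key
  have hcos : Complex.cos (Real.pi * w / (Kone q : ℂ)) = (Z + Z⁻¹) / 2 := by
    have : (Real.pi * w / (Kone q : ℂ)) = 2 * φ := by rw [hφ]; rw [mul_comm (2:ℂ), ← div_div]; ring
    rw [this, Complex.cos, ← hZi, hZ]
    congr 3 <;> ring
  have hqn : ‖(q : ℂ) ^ 2‖ < 1 := by
    rw [norm_pow, Complex.norm_real, Real.norm_eq_abs, abs_of_pos hq0]; nlinarith
  set p := (q : ℂ) ^ 2 with hpq
  have hgeo : Summable fun n : ℕ => ‖p ^ (n + 1)‖ := by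
    simp only [norm_pow p]
    exact (summable_geometric_of_lt_one (norm_nonneg _) hqn).comp_injective (add_left_injective 1)
  have hmul : Multipliable fun n : ℕ => ((1 - 2 * (q : ℂ) ^ (2 * n + 2) * Complex.cos (Real.pi * w / (Kone q : ℂ)) +
          (q : ℂ) ^ (4 * n + 4)) * (1 - (q : ℂ) ^ (2 * n + 2))) := by
    have m0 : ∀ c : ℂ, Multipliable fun n : ℕ => 1 + (c * p ^ (n + 1)) := fun c =>
      multipliable_one_add_of_summable (by simpa only [norm_mul] using hgeo.mul_left ‖c‖)
    refine (((m0 (-Z)).mul (m0 (-Z⁻¹))).mul (m0 (-1))).congr fun n => ?_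
    rw [hcos, show (q : ℂ) ^ (2 * n + 2) = p ^ (n + 1) by rw [hpq, ← pow_mul]; congr 1,
      show (q : ℂ) ^ (4 * n + 4) = p ^ (n + 1) * p ^ (n + 1) by rw [hpq, ← pow_mul, ← pow_add]; congr 1; ring]
    field_simp
    ring
  have hT := hmul.tendsto_prod_tprod_nat
  set T := ∏' n : ℕ, ((1 - 2 * (q : ℂ) ^ (2 * n + 2) * Complex.cos (Real.pi * w / (Kone q : ℂ)) +
          (q : ℂ) ^ (4 * n + 4)) * (1 - (q : ℂ) ^ (2 * n + 2))) with hTdef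
  have hlim : jacobiTheta₂ (φ / Real.pi + (1 / 2 - τ / 2)) τ = (1 - Z) * T := by
    have t1 : Tendsto (fun n : ℕ => 1 - Z * p ^ n) atTop (𝓝 (1 - Z * 0)) :=
      tendsto_const_nhds.sub ((tendsto_pow_atTop_nhds_zero_of_norm_lt_one hqn).const_mul Z)
    have t2 := key.mul t1
    have t3 := hT.const_mul (1 - Z)
    rw [mul_zero, sub_zero, mul_one] at t2
    refine tendsto_nhds_unique (t2.congr fun n => ?_) t3
    induction n with
    | zero => simp [qpoc]
    | succ n ih =>
      rw [Finset.prod_range_succ, Finset.prod_range_succ, qpoc_succ, ← mul_assoc (1 - Z), ← ih]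
      rw [hcos, show (q : ℂ) ^ (2 * n + 2) = p ^ (n + 1) by rw [hpq, ← pow_mul]; congr 1,
        show (q : ℂ) ^ (4 * n + 4) = p ^ (n + 1) * p ^ (n + 1) by rw [hpq, ← pow_mul, ← pow_add]; congr 1; ring]
      have : 1 - 2 * p ^ (n + 1) * ((Z + Z⁻¹) / 2) + p ^ (n + 1) * p ^ (n + 1) =
        (1 - Z * p ^ (n + 1)) * (1 + p ^ (n + 1) * -Z⁻¹) := by field_simp; ring
      rw [this]
      ring
  rw [theta, hlim, ← hφ, ← hTdef, Complex.sin]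
  have h1 : exp (φ * I) = exp (-(I * φ)) * Z := by
    rw [hZ, ← Complex.exp_add]; congr 1; ring
  rw [h1, show -φ * I = -(I * φ) by ring]
  ring

theorem brak_facts (q : ℝ) (hq0 : 0 < q) (hq1 : q < 1) (lam : ℂ) :
    (∃ A B : ℂ → ℂ, ∀ x y, brak q lam (x + y) * brak q lam (x - y) = A x * B y - B x * A y) ∧
    Differentiable ℂ (brak q lam) ∧ ∀ x, brak q lam (-x) = - brak q lam x := by
  have hpi : (Real.pi : ℂ) ≠ 0 := by exact_mod_cast Real.pi_ne_zero
  obtain ⟨τ, hτ⟩ : ∃ τ : ℂ, τ = ((-Real.log q / Real.pi : ℝ) : ℂ) * I := ⟨_, rfl⟩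
  have hτ1 : Real.pi * I * τ = Real.log q := by
    rw [hτ]; push_cast; field_simp; rw [Complex.I_sq]; ring
  have hτ0 : 0 < τ.im := by
    rw [hτ, Complex.im_ofReal_mul, Complex.I_im, mul_one]
    exact div_pos (neg_pos.2 (Real.log_neg hq0 hq1)) Real.pi_pos
  have h2 : 0 < (2 * τ).im := by simpa using hτ0
  obtain ⟨κ, hκ⟩ : ∃ κ : ℂ, κ = Real.pi * lam / (2 * (Kone q : ℂ)) := ⟨_, rfl⟩
  obtain ⟨C, hC⟩ : ∃ C : ℂ, C = (q : ℂ) ^ (1 / 4 : ℂ) * I := ⟨_, rfl⟩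
  have hb : ∀ x, brak q lam x = C * (exp (-(I * (κ * x))) * jacobiTheta₂ (κ * x / Real.pi + (1 / 2 - τ / 2)) τ) := by
    intro x
    rw [brak, theta_eq q hq0 hq1 (lam * x) (κ * x) τ (by rw [hκ]; ring) hτ1 hτ0, hC]
  refine ⟨⟨fun x => C * C * (exp (2 * I * (κ * x)) * jacobiTheta₂ (2 * (κ * x) / Real.pi + τ) (2 * τ)),
    fun x => jacobiTheta₂ (2 * (κ * x) / Real.pi) (2 * τ), ?_⟩, ?_, ?_⟩
  · intro x y
    rw [hb, hb]
    have h := jt_mul (κ * (x + y) / Real.pi + (1 / 2 - τ / 2)) (κ * (x - y) / Real.pi + (1 / 2 - τ / 2)) τ hτ0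
    have e1 : κ * (x + y) / Real.pi + (1 / 2 - τ / 2) + (κ * (x - y) / Real.pi + (1 / 2 - τ / 2))
        = (2 * (κ * x) / Real.pi - τ) + 1 := by ring
    have e2 : κ * (x + y) / Real.pi + (1 / 2 - τ / 2) - (κ * (x - y) / Real.pi + (1 / 2 - τ / 2))
        = 2 * (κ * y) / Real.pi := by ring
    have e3 : (2 * (κ * x) / Real.pi - τ) + 1 + τ = 2 * (κ * x) / Real.pi + 1 := by ring
    have e4 : exp (2 * Real.pi * I * (κ * (x + y) / Real.pi + (1 / 2 - τ / 2)) + Real.pi * I * τ)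
        = - exp (2 * I * (κ * (x + y))) := by
      rw [show 2 * Real.pi * I * (κ * (x + y) / Real.pi + (1 / 2 - τ / 2)) + Real.pi * I * τ
        = 2 * I * (κ * (x + y)) + Real.pi * I by field_simp; ring, Complex.exp_add, Complex.exp_pi_mul_I]
      ring
    rw [e1, e2, e3, e4, jacobiTheta₂_add_left, jacobiTheta₂_add_left] at h
    have h5 := jacobiTheta₂_add_left' (2 * (κ * x) / Real.pi - τ) (2 * τ)
    rw [show 2 * (κ * x) / Real.pi - τ + 2 * τ = 2 * (κ * x) / Real.pi + τ by ring,
      show -Real.pi * I * (2 * τ + 2 * (2 * (κ * x) / Real.pi - τ)) = -(4 * I * (κ * x)) by field_simp; ring] at h5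
    have h6 : exp (-(I * (κ * (x + y)))) * exp (-(I * (κ * (x - y)))) = exp (-(2 * I * (κ * x))) := by
      rw [← Complex.exp_add]; congr 1; ring
    have h7 : exp (2 * I * (κ * x)) * exp (-(4 * I * (κ * x))) = exp (-(2 * I * (κ * x))) := by
      rw [← Complex.exp_add]; congr 1; ring
    have h8 : exp (-(2 * I * (κ * x))) * exp (2 * I * (κ * (x + y))) = exp (2 * I * (κ * y)) := by
      rw [← Complex.exp_add]; congr 1; ring
    calc _ = C * C * ((exp (-(I * (κ * (x + y)))) * exp (-(I * (κ * (x - y))))) *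
          (jacobiTheta₂ (κ * (x + y) / Real.pi + (1 / 2 - τ / 2)) τ * jacobiTheta₂ (κ * (x - y) / Real.pi + (1 / 2 - τ / 2)) τ)) := by ring
      _ = _ := by
        simp only []
        rw [h6, h, h5, ← h8, ← mul_assoc (exp (2 * I * (κ * x))), h7]
        ring
  · have : brak q lam = fun x => C * (exp (-(I * (κ * x))) * jacobiTheta₂ (κ * x / Real.pi + (1 / 2 - τ / 2)) τ) :=
      funext hb
    rw [this]
    intro x
    have hd : DifferentiableAt ℂ (fun x : ℂ => jacobiTheta₂ (κ * x / Real.pi + (1 / 2 - τ / 2)) τ) x :=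
      (differentiableAt_jacobiTheta₂_fst _ hτ0).comp x (f := fun x => κ * x / Real.pi + (1 / 2 - τ / 2)) (by fun_prop)
    fun_prop
  · intro x
    rw [brak, brak, theta, theta]
    have e1 : Real.pi * (lam * -x) / (2 * (Kone q : ℂ)) = -(Real.pi * (lam * x) / (2 * (Kone q : ℂ))) := by ring
    have e2 : Real.pi * (lam * -x) / (Kone q : ℂ) = -(Real.pi * (lam * x) / (Kone q : ℂ)) := by ring
    rw [e1, e2, Complex.sin_neg, Complex.cos_neg]
    ring

end

section
open Complex Filter Topology

namespace DM

/-- The exterior algebra in which the rows of the lattice live. -/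
abbrev EA := ExteriorAlgebra ℂ (ℕ →₀ ℂ)

/-- Basis vector at a column. -/
noncomputable def bv (m : ℕ) : EA := ExteriorAlgebra.ι ℂ (Finsupp.single m (1 : ℂ))

/-- Ordered product of the basis vectors of `S` below `m`. -/
noncomputable def ket (S : Finset ℕ) : ℕ → EA
  | 0 => 1
  | m + 1 => if m ∈ S then ket S m * bv m else ket S m

/-- Difference of the number of particles of the lower and the upper row below `m`. -/
def dd (S S' : Finset ℕ) (m : ℕ) : ℤ :=
  ((S'.filter (· < m)).card : ℤ) - ((S.filter (· < m)).card : ℤ)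

/-- Vertex weights. -/
noncomputable def vX (b : ℂ → ℂ) (α t : ℂ) (d : ℤ) (tp bt : Prop) [Decidable tp] [Decidable bt] : ℂ :=
  if d = 0 then
    (if tp then (if bt then b t * b (α - 1) / (b 1 * b α) else 0)
      else (if bt then b (α - t) / b α else b (1 + t) / b 1))
  else if d = 1 then
    (if tp then (if bt then b (1 - t) / b 1 else b (-α - t) / b (-α))
      else (if bt then 0 else b t * b (-α - 1) / (b 1 * b (-α))))
  else 0

/-- Row weight of the first `m` columns. -/
noncomputable def Rw (b : ℂ → ℂ) (α t : ℕ → ℂ) (S S' : Finset ℕ) (m : ℕ) : ℂ :=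
  ∏ k ∈ Finset.range m, vX b (α k) (t k) (dd S S' k) (k ∈ S) (k ∈ S')

lemma card_filter_succ (S : Finset ℕ) (m : ℕ) :
    ((S.filter (· < m + 1)).card : ℤ) = (S.filter (· < m)).card + if m ∈ S then 1 else 0 := by
  split_ifs with h
  · have : S.filter (· < m + 1) = insert m (S.filter (· < m)) := by
      ext k
      simp only [Finset.mem_filter, Finset.mem_insert]
      constructor
      · rintro ⟨h1, h2⟩
        rcases Nat.lt_succ_iff_lt_or_eq.1 h2 with h3 | h3
        · exact Or.inr ⟨h1, h3⟩
        · exact Or.inl h3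
      · rintro (rfl | ⟨h1, h2⟩)
        · exact ⟨h, by omega⟩
        · exact ⟨h1, by omega⟩
    rw [this, Finset.card_insert_of_notMem (by simp)]
    push_cast; rfl
  · have : S.filter (· < m + 1) = S.filter (· < m) := by
      ext k
      simp only [Finset.mem_filter]
      constructor
      · rintro ⟨h1, h2⟩
        refine ⟨h1, ?_⟩
        rcases Nat.lt_succ_iff_lt_or_eq.1 h2 with h3 | h3
        · exact h3
        · exact absurd (h3 ▸ h1) h
      · rintro ⟨h1, h2⟩; exact ⟨h1, by omega⟩
    rw [this]; simp

lemma dd_succ (S S' : Finset ℕ) (m : ℕ) : dd S S' (m + 1) =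
    dd S S' m + (if m ∈ S' then 1 else 0) - (if m ∈ S then 1 else 0) := by
  rw [dd, dd, card_filter_succ, card_filter_succ]; ring

lemma dd_zero (S S' : Finset ℕ) : dd S S' 0 = 0 := by simp [dd]

lemma dd_congr (S S' S'' : Finset ℕ) (m : ℕ) (h : ∀ k < m, k ∈ S' ↔ k ∈ S'') : dd S S' m = dd S S'' m := by
  have : S'.filter (· < m) = S''.filter (· < m) := by
    ext k
    simp only [Finset.mem_filter]
    constructor
    · rintro ⟨h1, h2⟩; exact ⟨(h k h2).1 h1, h2⟩
    · rintro ⟨h1, h2⟩; exact ⟨(h k h2).2 h1, h2⟩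
  rw [dd, dd, this]

lemma ket_congr (S' S'' : Finset ℕ) (m : ℕ) (h : ∀ k < m, k ∈ S' ↔ k ∈ S'') : ket S' m = ket S'' m := by
  induction m with
  | zero => rfl
  | succ m ih =>
    rw [ket, ket, ih fun k hk => h k (by omega)]
    simp only [h m (by omega)]

lemma Rw_congr (b : ℂ → ℂ) (α t : ℕ → ℂ) (S S' S'' : Finset ℕ) (m : ℕ) (h : ∀ k < m, k ∈ S' ↔ k ∈ S'') :
    Rw b α t S S' m = Rw b α t S S'' m := by
  refine Finset.prod_congr rfl fun k hk => ?_
  have hk' := Finset.mem_range.1 hk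
  rw [dd_congr S S' S'' k fun j hj => h j (by omega)]
  simp only [h k hk']

/-- Row operator on the first `m` columns applied to `S`, right vertical state `d`. -/
noncomputable def rowSum (b : ℂ → ℂ) (α t : ℕ → ℂ) (S : Finset ℕ) (d : ℤ) (m : ℕ) : EA :=
  ∑ S' ∈ (Finset.range m).powerset, if dd S S' m = d then Rw b α t S S' m • ket S' m else 0

lemma rowSum_succ (b : ℂ → ℂ) (α t : ℕ → ℂ) (S : Finset ℕ) (d e : ℤ) (m : ℕ)
    (he : e = d + (if m ∈ S then 1 else 0)) :
    rowSum b α t S d (m + 1) =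
      vX b (α m) (t m) e (m ∈ S) False • rowSum b α t S e m +
      vX b (α m) (t m) (e - 1) (m ∈ S) True • (rowSum b α t S (e - 1) m * bv m) := by
  rw [rowSum, Finset.range_add_one, Finset.sum_powerset_insert Finset.notMem_range_self]
  congr 1
  · rw [rowSum, Finset.smul_sum]
    refine Finset.sum_congr rfl fun S' hS' => ?_
    have hm : m ∉ S' := fun h => Finset.notMem_range_self (Finset.mem_powerset.1 hS' h)
    rw [dd_succ, Rw, Finset.prod_range_succ, ket, ← Rw]
    simp only [hm, if_false]
    by_cases hd : dd S S' m = e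
    · rw [if_pos (by rw [hd, he]; ring), if_pos hd, hd, mul_comm, mul_smul]
    · rw [if_neg (by rw [he] at hd; intro h; apply hd; linarith), if_neg hd, smul_zero]
  · rw [rowSum, Finset.sum_mul, Finset.smul_sum]
    refine Finset.sum_congr rfl fun S' hS' => ?_
    have hm : m ∉ S' := fun h => Finset.notMem_range_self (Finset.mem_powerset.1 hS' h)
    have hc : ∀ k < m, k ∈ insert m S' ↔ k ∈ S' := fun k hk => by
      rw [Finset.mem_insert]; exact ⟨fun h => h.resolve_left (by omega), Or.inr⟩
    have hmi : m ∈ insert m S' := Finset.mem_insert_self _ _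
    rw [dd_succ, Rw, Finset.prod_range_succ, ket, ← Rw, dd_congr S _ S' m hc, Rw_congr b α t S _ S' m hc,
      ket_congr _ S' m hc]
    simp only [hmi, if_true]
    by_cases hd : dd S S' m = e - 1
    · rw [if_pos (by rw [hd, he]; ring), if_pos hd, hd, mul_comm, mul_smul, smul_mul_assoc]
    · rw [if_neg (by rw [he] at hd; intro h; apply hd; linarith), if_neg hd, zero_mul, smul_zero]

/-- The one-particle vector created by a row. -/
noncomputable def wv (b : ℂ → ℂ) (α t : ℕ → ℂ) : ℕ → (ℕ →₀ ℂ)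
  | 0 => 0
  | m + 1 => (b (t m) * b (-α m - 1) / (b 1 * b (-α m)) / (b (1 + t m) / b 1)) • wv b α t m +
      (b (α m - t m) / b (α m) / (b (1 + t m) / b 1)) • Finsupp.single m 1

/-- The one-particle operator of a row. -/
noncomputable def Gop (b : ℂ → ℂ) (α t : ℕ → ℂ) : (ℕ →₀ ℂ) →ₗ[ℂ] (ℕ →₀ ℂ) :=
  Finsupp.linearCombination ℂ fun m =>
    (b (t m) * b (α m - 1) / (b 1 * b (α m)) / (b (1 + t m) / b 1)) • Finsupp.single m 1 +
    (b (-α m - t m) / b (-α m) / (b (1 + t m) / b 1)) • wv b α t m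

/-- The vacuum weight. -/
noncomputable def vac (b : ℂ → ℂ) (t : ℕ → ℂ) (m : ℕ) : ℂ := ∏ k ∈ Finset.range m, (b (1 + t k) / b 1)

lemma Gop_single (b : ℂ → ℂ) (α t : ℕ → ℂ) (m : ℕ) : Gop b α t (Finsupp.single m 1) =
    (b (t m) * b (α m - 1) / (b 1 * b (α m)) / (b (1 + t m) / b 1)) • Finsupp.single m 1 +
    (b (-α m - t m) / b (-α m) / (b (1 + t m) / b 1)) • wv b α t m := by
  rw [Gop, Finsupp.linearCombination_single, one_smul]

lemma ι_anti (x y : ℕ →₀ ℂ) : ExteriorAlgebra.ι ℂ x * ExteriorAlgebra.ι ℂ y =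
    -(ExteriorAlgebra.ι ℂ y * ExteriorAlgebra.ι ℂ x) :=
  eq_neg_of_add_eq_zero_left (ExteriorAlgebra.ι_add_mul_swap x y)

lemma rowSum_eq (b : ℂ → ℂ) (α t : ℕ → ℂ) (hodd : ∀ x, b (-x) = - b x)
    (hff : ∀ α t, b (1 + t) * b (1 - t) * (b α * b α) =
      b (α + t) * b (α - t) * (b 1 * b 1) - b t * b t * (b (α - 1) * b (α + 1)))
    (h1 : b 1 ≠ 0) (hα : ∀ k, b (α k) ≠ 0) (S : Finset ℕ) (m : ℕ) (ht : ∀ k < m, b (1 + t k) ≠ 0) :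
    rowSum b α t S 0 m = vac b t m • ExteriorAlgebra.map (Gop b α t) (ket S m) ∧
    rowSum b α t S 1 m = vac b t m • (ExteriorAlgebra.map (Gop b α t) (ket S m) *
      ExteriorAlgebra.ι ℂ (wv b α t m)) := by
  induction m with
  | zero =>
    simp [rowSum, dd_zero, Rw, ket, vac, wv]
  | succ m ih =>
    obtain ⟨ih0, ih1⟩ := ih fun k hk => ht k (by omega)
    have ht' : b (1 + t m) ≠ 0 := ht m (by omega)
    have hα' := hα m
    have hαn : b (-α m) ≠ 0 := by rw [hodd]; exact neg_ne_zero.2 hα'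
    have ha : b (1 + t m) / b 1 ≠ 0 := div_ne_zero (ht m (by omega)) h1
    have hv : vac b t (m + 1) = vac b t m * (b (1 + t m) / b 1) := Finset.prod_range_succ _ _
    set X := ExteriorAlgebra.map (Gop b α t) (ket S m) with hX
    set W := ExteriorAlgebra.ι ℂ (wv b α t m) with hW
    have hW1 : ExteriorAlgebra.ι ℂ (wv b α t (m + 1)) =
      (b (t m) * b (-α m - 1) / (b 1 * b (-α m)) / (b (1 + t m) / b 1)) • W +
      (b (α m - t m) / b (α m) / (b (1 + t m) / b 1)) • bv m := by
      rw [wv, map_add, map_smul, map_smul]; rfl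
    have hG : ExteriorAlgebra.map (Gop b α t) (bv m) =
        (b (t m) * b (α m - 1) / (b 1 * b (α m)) / (b (1 + t m) / b 1)) • bv m +
        (b (-α m - t m) / b (-α m) / (b (1 + t m) / b 1)) • W := by
      rw [bv, ExteriorAlgebra.map_apply_ι, Gop_single, map_add, map_smul, map_smul]
    have hbb : bv m * bv m = 0 := ExteriorAlgebra.ι_sq_zero _
    have hWW : W * W = 0 := ExteriorAlgebra.ι_sq_zero _
    have hbW : bv m * W = -(W * bv m) := ι_anti _ _
    by_cases hm : m ∈ S
    · have hk : ExteriorAlgebra.map (Gop b α t) (ket S (m + 1)) = X *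
        ((b (t m) * b (α m - 1) / (b 1 * b (α m)) / (b (1 + t m) / b 1)) • bv m +
        (b (-α m - t m) / b (-α m) / (b (1 + t m) / b 1)) • W) := by
        rw [ket, if_pos hm, map_mul, hG]
      constructor
      · rw [rowSum_succ b α t S 0 1 m (by simp [hm]), hk, hv]
        norm_num [vX, hm]
        rw [ih0, ih1, mul_add, smul_add, mul_smul_comm, mul_smul_comm, smul_smul, smul_smul, smul_mul_assoc,
          smul_smul, smul_smul, add_comm]
        congr 2 <;> field_simp
      · rw [rowSum_succ b α t S 1 2 m (by simp [hm]), hk, hv, hW1]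
        norm_num [vX, hm]
        rw [ih1, mul_assoc X, add_mul, mul_add, mul_add]
        simp only [mul_smul_comm, smul_mul_assoc, hbb, hWW, hbW, smul_zero, add_zero, zero_add, mul_add, smul_neg,
          mul_neg, smul_smul, smul_add, mul_assoc]
        rw [← neg_smul, ← add_smul]
        congr 1
        have h2 := hff (α m) (t m)
        rw [hodd, show -α m - t m = -(α m + t m) by ring, hodd, show -α m - 1 = -(α m + 1) by ring, hodd]
        field_simp
        linear_combination (vac b t m) * h2
    · have hk : ExteriorAlgebra.map (Gop b α t) (ket S (m + 1)) = X := by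
        rw [ket, if_neg hm]
      constructor
      · rw [rowSum_succ b α t S 0 0 m (by simp [hm]), hk, hv]
        norm_num [vX, hm]
        rw [ih0, smul_smul, mul_comm]
      · rw [rowSum_succ b α t S 1 1 m (by simp [hm]), hk, hv, hW1]
        norm_num [vX, hm]
        rw [ih0, ih1, mul_add, smul_add, mul_smul_comm, mul_smul_comm, smul_smul, smul_smul, smul_mul_assoc,
          smul_smul, smul_smul]
        congr 2 <;> field_simp

end DM

end

section
open Complex Filter Topology

namespace DM

lemma plucker (b : ℂ → ℂ) (hAB : ∃ A B : ℂ → ℂ, ∀ x y, b (x + y) * b (x - y) = A x * B y - B x * A y)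
    (x y z w : ℂ) : b (x + z) * b (x - z) * (b (y + w) * b (y - w)) - b (x + w) * b (x - w) * (b (y + z) * b (y - z)) =
      b (x + y) * b (x - y) * (b (z + w) * b (z - w)) := by
  obtain ⟨A, B, h⟩ := hAB
  simp only [h]; ring

lemma idI (b : ℂ → ℂ) (hAB : ∃ A B : ℂ → ℂ, ∀ x y, b (x + y) * b (x - y) = A x * B y - B x * A y)
    (α t : ℂ) : b (1 + t) * b (1 - t) * (b α * b α) =
      b (α + t) * b (α - t) * (b 1 * b 1) - b t * b t * (b (α - 1) * b (α + 1)) := by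
  have h := plucker b hAB α 1 t 0
  simp only [add_zero, sub_zero] at h
  linear_combination -h

lemma idII (b : ℂ → ℂ) (hodd : ∀ x, b (-x) = - b x)
    (hAB : ∃ A B : ℂ → ℂ, ∀ x y, b (x + y) * b (x - y) = A x * B y - B x * A y)
    (α s δ : ℂ) : b (α - 1 - s) * b (s + δ) * b (α + 1) * b δ + b (1 - δ) * b (α - s) * b (1 + (s + δ)) * b α =
      b (α - (s + δ)) * b (1 + s) * b (α + δ) * b 1 := by
  have h := plucker b hAB (α - s / 2) (δ + s / 2) (1 + s / 2) (s / 2)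
  rw [show α - s / 2 + (1 + s / 2) = α + 1 by ring, show α - s / 2 - (1 + s / 2) = α - 1 - s by ring,
    show δ + s / 2 + s / 2 = s + δ by ring, show δ + s / 2 - s / 2 = δ by ring,
    show α - s / 2 + s / 2 = α by ring, show α - s / 2 - s / 2 = α - s by ring,
    show δ + s / 2 + (1 + s / 2) = 1 + (s + δ) by ring, show δ + s / 2 - (1 + s / 2) = -(1 - δ) by ring,
    show α - s / 2 + (δ + s / 2) = α + δ by ring, show α - s / 2 - (δ + s / 2) = α - (s + δ) by ring,
    show 1 + s / 2 + s / 2 = 1 + s by ring, show 1 + s / 2 - s / 2 = 1 by ring, hodd] at h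
  linear_combination h

lemma idIII (b : ℂ → ℂ) (hodd : ∀ x, b (-x) = - b x)
    (hAB : ∃ A B : ℂ → ℂ, ∀ x y, b (x + y) * b (x - y) = A x * B y - B x * A y)
    (α s δ : ℂ) : b s * b (α - 1 + δ) * b (1 + (s + δ)) * b α + b (α - 1 - s) * b (α + (s + δ)) * b δ * b 1 =
      b (1 + s) * b (α + δ) * b (s + δ) * b (α - 1) := by
  have h := plucker b hAB (α + (δ - 1) / 2) ((δ + 1) / 2) ((1 + 2 * s + δ) / 2) ((1 - δ) / 2)
  rw [show α + (δ - 1) / 2 + (1 + 2 * s + δ) / 2 = α + (s + δ) by ring,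
    show α + (δ - 1) / 2 - (1 + 2 * s + δ) / 2 = α - 1 - s by ring,
    show (δ + 1) / 2 + (1 - δ) / 2 = 1 by ring, show (δ + 1) / 2 - (1 - δ) / 2 = δ by ring,
    show α + (δ - 1) / 2 + (1 - δ) / 2 = α by ring, show α + (δ - 1) / 2 - (1 - δ) / 2 = α - 1 + δ by ring,
    show (δ + 1) / 2 + (1 + 2 * s + δ) / 2 = 1 + (s + δ) by ring,
    show (δ + 1) / 2 - (1 + 2 * s + δ) / 2 = -s by ring,
    show α + (δ - 1) / 2 + (δ + 1) / 2 = α + δ by ring, show α + (δ - 1) / 2 - (δ + 1) / 2 = α - 1 by ring,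
    show (1 + 2 * s + δ) / 2 + (1 - δ) / 2 = 1 + s by ring,
    show (1 + 2 * s + δ) / 2 - (1 - δ) / 2 = s + δ by ring, hodd] at h
  linear_combination h

/-- Normalised one-particle vector. -/
noncomputable def Psi (b : ℂ → ℂ) (c : ℂ) (s : ℕ → ℂ) : ℕ → (ℕ →₀ ℂ)
  | 0 => 0
  | m + 1 => (b (s m) / b 1) • Psi b c s m +
      (b (c + m - 1 - s m) / (b (c + m - 1) * b (c + m)) * vac b s m) • Finsupp.single m 1

lemma vac_succ (b : ℂ → ℂ) (t : ℕ → ℂ) (m : ℕ) : vac b t (m + 1) = vac b t m * (b (1 + t m) / b 1) :=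
  Finset.prod_range_succ _ _

lemma vac_wv (b : ℂ → ℂ) (hodd : ∀ x, b (-x) = - b x) (h1 : b 1 ≠ 0) (c : ℂ) (hc : ∀ k : ℤ, b (c + k) ≠ 0)
    (t : ℕ → ℂ) (m : ℕ) (ht : ∀ k < m, b (1 + t k) ≠ 0) :
    vac b t m • wv b (fun k => c + k) t m = b (c + m) • Psi b (c + 1) t m := by
  induction m with
  | zero => simp [wv, Psi]
  | succ m ih =>
    have ih := ih fun k hk => ht k (by omega)
    have ht' := ht m (by omega)
    have hα : b (c + m) ≠ 0 := by simpa using hc m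
    have hα1 : b (c + m + 1) ≠ 0 := by simpa [add_assoc] using hc (m + 1)
    rw [wv, Psi, vac_succ]
    rw [show -(c + (m : ℂ)) - 1 = -(c + m + 1) by ring, hodd, hodd]
    rw [show c + 1 + (m : ℂ) - 1 = c + m by ring, show c + 1 + (m : ℂ) = c + m + 1 by ring,
      show c + ((m + 1 : ℕ) : ℂ) = c + m + 1 by push_cast; ring]
    have e1 : vac b t m * (b (1 + t m) / b 1) * (b (t m) * -b (c + m + 1) / (b 1 * -b (c + m)) / (b (1 + t m) / b 1)) =
      b (t m) * b (c + m + 1) / (b 1 * b (c + m)) * vac b t m := by field_simp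
    have e2 : vac b t m * (b (1 + t m) / b 1) * (b (c + m - t m) / b (c + m) / (b (1 + t m) / b 1)) =
      b (c + m + 1) * (b (c + m - t m) / (b (c + m) * b (c + m + 1)) * vac b t m) := by field_simp
    have e3 : b (t m) * b (c + m + 1) / (b 1 * b (c + m)) * b (c + m) = b (c + m + 1) * (b (t m) / b 1) := by
      field_simp
    rw [smul_add, smul_smul, smul_smul, e1, e2, mul_smul, ih, smul_smul, e3, smul_add, smul_smul, smul_smul]

lemma Gop_Psi (b : ℂ → ℂ) (hodd : ∀ x, b (-x) = - b x) (h1 : b 1 ≠ 0)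
    (hAB : ∃ A B : ℂ → ℂ, ∀ x y, b (x + y) * b (x - y) = A x * B y - B x * A y)
    (c : ℂ) (hc : ∀ k : ℤ, b (c + k) ≠ 0)
    (s t : ℕ → ℂ) (δ : ℂ) (hδ : b δ ≠ 0) (hst : ∀ k, t k = s k + δ) (m : ℕ) (ht : ∀ k < m, b (1 + t k) ≠ 0) :
    Gop b (fun k => c + k) t (Psi b c s m) = (b (1 - δ) / b (-δ)) • Psi b (c + 1) s m +
      (vac b s m * b 1 * b (c + m - 1 + δ) / (b (c + m - 1) * b (c + m) * b δ)) •
        wv b (fun k => c + k) t m := by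
  induction m with
  | zero => simp [wv, Psi]
  | succ m ih =>
    have ih := ih fun k hk => ht k (by omega)
    have ht' := ht m (by omega)
    rw [hst] at ht'
    have hα : b (c + m) ≠ 0 := by simpa using hc m
    have hα1 : b (c + m + 1) ≠ 0 := by simpa [add_assoc] using hc (m + 1)
    have hαm : b (c + m - 1) ≠ 0 := by
      have := hc (m - 1); push_cast at this; rwa [← add_sub_assoc] at this
    rw [Psi, Psi, wv, map_add, map_smul, map_smul, ih, Gop_single, vac_succ]
    have II := idII b hodd hAB (c + m) (s m) δ
    have III := idIII b hodd hAB (c + m) (s m) δ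
    rw [show c + 1 + (m : ℂ) - 1 = c + m by ring, show c + 1 + (m : ℂ) = c + m + 1 by ring,
      show c + ((m + 1 : ℕ) : ℂ) - 1 = c + m by push_cast; ring,
      show c + ((m + 1 : ℕ) : ℂ) = c + m + 1 by push_cast; ring,
      show -(c + (m : ℂ)) - 1 = -(c + m + 1) by ring, hst m,
      show -(c + (m : ℂ)) - (s m + δ) = -(c + m + (s m + δ)) by ring, hodd, hodd, hodd, hodd]
    generalize b (c + m) = p0 at *
    generalize b (c + m + 1) = p1 at *
    generalize b (c + m - 1) = pm at *
    generalize b (c + m - 1 - s m) = p2 at *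
    generalize b (c + m - s m) = p3 at *
    generalize b (c + m + δ) = p4 at *
    generalize b (c + m - 1 + δ) = p5 at *
    generalize b (c + m + (s m + δ)) = p6 at *
    generalize b (c + m - (s m + δ)) = p7 at *
    generalize b (1 + (s m + δ)) = p8 at *
    generalize b (s m + δ) = p9 at *
    generalize b (1 + s m) = r1 at *
    generalize b (s m) = r2 at *
    generalize b (1 - δ) = r3 at *
    generalize b δ = r4 at *
    generalize b 1 = r5 at *
    generalize vac b s m = P at *
    have e1 : p2 / (pm * p0) * P * (p9 * pm / (r5 * p0) / (p8 / r5)) =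
      r3 / -r4 * (p3 / (p0 * p1) * P) + P * (r1 / r5) * r5 * p4 / (p0 * p1 * r4) * (p7 / p0 / (p8 / r5)) := by
      field_simp
      linear_combination P * II
    have e2 : r2 / r5 * (P * r5 * p5 / (pm * p0 * r4)) + p2 / (pm * p0) * P * (-p6 / -p0 / (p8 / r5)) =
      P * (r1 / r5) * r5 * p4 / (p0 * p1 * r4) * (p9 * -p1 / (r5 * -p0) / (p8 / r5)) := by
      field_simp
      linear_combination P * III
    linear_combination (norm := module) e1 • (Finsupp.single m (1:ℂ)) + e2 • wv b (fun k => c + k) t m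

end DM

end

section
open Complex Filter Topology

namespace DM

/-- Ordered product of the first `n` vectors. -/
noncomputable def chain (f : ℕ → (ℕ →₀ ℂ)) : ℕ → EA
  | 0 => 1
  | n + 1 => chain f n * ExteriorAlgebra.ι ℂ (f n)

lemma chain_map (G : (ℕ →₀ ℂ) →ₗ[ℂ] (ℕ →₀ ℂ)) (f : ℕ → (ℕ →₀ ℂ)) (n : ℕ) :
    ExteriorAlgebra.map G (chain f n) = chain (fun i => G (f i)) n := by
  induction n with
  | zero => simp [chain]
  | succ n ih => rw [chain, chain, map_mul, ih, ExteriorAlgebra.map_apply_ι]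

lemma chain_congr (f g : ℕ → (ℕ →₀ ℂ)) (n : ℕ) (h : ∀ i < n, f i = g i) : chain f n = chain g n := by
  induction n with
  | zero => simp [chain]
  | succ n ih => rw [chain, chain, ih fun i hi => h i (by omega), h n (by omega)]

lemma chain_mul_w (f : ℕ → (ℕ →₀ ℂ)) (κ c : ℕ → ℂ) (w : ℕ →₀ ℂ) (n : ℕ) :
    chain (fun i => κ i • f i + c i • w) n * ExteriorAlgebra.ι ℂ w =
      (∏ i ∈ Finset.range n, κ i) • (chain f n * ExteriorAlgebra.ι ℂ w) := by
  induction n with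
  | zero => simp [chain]
  | succ n ih =>
    have hww : ExteriorAlgebra.ι ℂ w * ExteriorAlgebra.ι ℂ w = 0 := ExteriorAlgebra.ι_sq_zero _
    rw [chain, chain, Finset.prod_range_succ, map_add, map_smul, map_smul, mul_assoc, add_mul,
      smul_mul_assoc, smul_mul_assoc, hww, smul_zero, add_zero, ι_anti, smul_neg, mul_neg, mul_smul_comm,
      ← mul_assoc, ih, mul_assoc (chain f n), ι_anti (f n) w, smul_mul_assoc, smul_smul, mul_neg, smul_neg,
      ← mul_assoc, mul_comm (κ n)]

/-- Partition function by rows. -/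
noncomputable def Zf (b : ℂ → ℂ) (a : ℂ) (w vv : ℕ → ℂ) (M : ℕ) : ℕ → Finset ℕ → ℂ
  | 0 => fun S => if S = ∅ then 1 else 0
  | n + 1 => fun S' => ∑ S ∈ (Finset.range M).powerset, Zf b a w vv M n S *
      (if dd S S' M = 1 then Rw b (fun k => a + n + k) (fun k => w n - vv k) S S' M else 0)

/-- State vector after `n` rows. -/
noncomputable def Vec (b : ℂ → ℂ) (a : ℂ) (w vv : ℕ → ℂ) (M n : ℕ) : EA :=
  ∑ S ∈ (Finset.range M).powerset, Zf b a w vv M n S • ket S M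

lemma ket_empty (m : ℕ) : ket ∅ m = 1 := by
  induction m with
  | zero => rfl
  | succ m ih => rw [ket, if_neg (by simp), ih]

/-- Normalisation constant. -/
noncomputable def Kn (b : ℂ → ℂ) (a : ℂ) (w : ℕ → ℂ) (M n : ℕ) : ℂ :=
  ∏ j ∈ Finset.range n, (b (a + j + M) * ∏ i ∈ Finset.range j, (b (1 - (w j - w i)) / b (-(w j - w i))))

lemma Vec_succ (b : ℂ → ℂ) (hodd : ∀ x, b (-x) = - b x) (h1 : b 1 ≠ 0)
    (hAB : ∃ A B : ℂ → ℂ, ∀ x y, b (x + y) * b (x - y) = A x * B y - B x * A y)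
    (a : ℂ) (ha : ∀ k : ℤ, b (a + k) ≠ 0) (w vv : ℕ → ℂ) (M n : ℕ)
    (ht : ∀ k < M, b (1 + (w n - vv k)) ≠ 0) :
    Vec b a w vv M (n + 1) = vac b (fun k => w n - vv k) M •
      (ExteriorAlgebra.map (Gop b (fun k => a + n + k) (fun k => w n - vv k)) (Vec b a w vv M n) *
        ExteriorAlgebra.ι ℂ (wv b (fun k => a + n + k) (fun k => w n - vv k) M)) := by
  have hα : ∀ k : ℕ, b (a + n + k) ≠ 0 := fun k => by
    have := ha (n + k); push_cast at this; rwa [← add_assoc] at this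
  have hr : ∀ S, rowSum b (fun k => a + n + k) (fun k => w n - vv k) S 1 M = _ := fun S =>
    (rowSum_eq b (fun k => a + n + k) (fun k => w n - vv k) hodd (idI b hAB) h1 hα S M ht).2
  rw [Vec, Vec, map_sum, Finset.sum_mul, Finset.smul_sum]
  simp only [Zf, Finset.sum_smul]
  rw [Finset.sum_comm]
  refine Finset.sum_congr rfl fun S _ => ?_
  rw [map_smul, smul_mul_assoc, smul_comm, ← hr, rowSum, Finset.smul_sum]
  refine Finset.sum_congr rfl fun S' _ => ?_
  split_ifs
  · rw [mul_smul]
  · simp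

lemma Vec_eq (b : ℂ → ℂ) (hodd : ∀ x, b (-x) = - b x) (h1 : b 1 ≠ 0)
    (hAB : ∃ A B : ℂ → ℂ, ∀ x y, b (x + y) * b (x - y) = A x * B y - B x * A y)
    (a : ℂ) (ha : ∀ k : ℤ, b (a + k) ≠ 0) (w vv : ℕ → ℂ) (M n : ℕ)
    (ht : ∀ j < n, ∀ k < M, b (1 + (w j - vv k)) ≠ 0)
    (hw : ∀ j < n, ∀ i < j, b (w j - w i) ≠ 0) :
    Vec b a w vv M n = Kn b a w M n • chain (fun i => Psi b (a + n) (fun k => w i - vv k) M) n := by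
  induction n with
  | zero =>
    rw [Vec, Finset.sum_eq_single ∅]
    · simp [Zf, Kn, chain, ket_empty]
    · intro S _ hS; simp [Zf, hS]
    · intro h; exact absurd (Finset.empty_mem_powerset _) h
  | succ n ih =>
    have ih := ih (fun j hj => ht j (by omega)) (fun j hj => hw j (by omega))
    have hc : ∀ k : ℤ, b (a + n + k) ≠ 0 := fun k => by
      have := ha (n + k); push_cast at this; rwa [← add_assoc] at this
    rw [Vec_succ b hodd h1 hAB a ha w vv M n (ht n (by omega)), ih, map_smul, chain_map]
    rw [chain_congr _ (fun i => (b (1 - (w n - w i)) / b (-(w n - w i))) •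
      Psi b (a + n + 1) (fun k => w i - vv k) M +
      (vac b (fun k => w i - vv k) M * b 1 * b (a + n + M - 1 + (w n - w i)) /
        (b (a + n + M - 1) * b (a + n + M) * b (w n - w i))) •
        wv b (fun k => a + n + k) (fun k => w n - vv k) M) n
      (fun i hi => Gop_Psi b hodd h1 hAB (a + n) hc (fun k => w i - vv k) (fun k => w n - vv k) (w n - w i)
        (hw n (by omega) i hi) (fun k => by ring) M (ht n (by omega)))]
    rw [smul_mul_assoc, chain_mul_w]
    rw [show vac b (fun k => w n - vv k) M • Kn b a w M n • (∏ i ∈ Finset.range n, b (1 - (w n - w i)) / b (-(w n - w i))) •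
      (chain (fun i => Psi b (a + n + 1) (fun k => w i - vv k) M) n *
        ExteriorAlgebra.ι ℂ (wv b (fun k => a + n + k) (fun k => w n - vv k) M)) =
      (Kn b a w M n * (∏ i ∈ Finset.range n, b (1 - (w n - w i)) / b (-(w n - w i)))) •
      (chain (fun i => Psi b (a + n + 1) (fun k => w i - vv k) M) n *
        ExteriorAlgebra.ι ℂ (vac b (fun k => w n - vv k) M • wv b (fun k => a + n + k) (fun k => w n - vv k) M)) by
        rw [map_smul, mul_smul_comm, smul_smul, smul_smul, smul_smul]; congr 1; ring]
    rw [vac_wv b hodd h1 (a + n) hc _ M (ht n (by omega)), map_smul, mul_smul_comm, smul_smul, chain]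
    rw [show a + ((n + 1 : ℕ) : ℂ) = a + n + 1 by push_cast; ring]
    congr 1
    rw [Kn, Kn, Finset.prod_range_succ]
    ring

end DM

end

section
open Complex Filter Topology

namespace DM

lemma Psi_apply (b : ℂ → ℂ) (c : ℂ) (s : ℕ → ℂ) (m x : ℕ) : Psi b c s m x =
    if x < m then (∏ k ∈ Finset.Ico (x + 1) m, (b (s k) / b 1)) *
      (b (c + x - 1 - s x) / (b (c + x - 1) * b (c + x)) * vac b s x) else 0 := by
  induction m with
  | zero => simp [Psi]
  | succ m ih =>
    rw [Psi, Finsupp.add_apply, Finsupp.smul_apply, Finsupp.smul_apply, ih]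
    rcases lt_trichotomy x m with h | h | h
    · rw [if_pos h, if_pos (by omega), Finset.prod_Ico_succ_top (by omega), Finsupp.single_apply, if_neg (by omega)]
      simp only [smul_eq_mul]; ring
    · subst h
      simp
    · rw [if_neg (by omega), if_neg (by omega), Finsupp.single_apply, if_neg (by omega)]
      simp

lemma chain_eq_ιMulti (f : ℕ → (ℕ →₀ ℂ)) (n : ℕ) : chain f n = ExteriorAlgebra.ιMulti ℂ n (fun i : Fin n => f i) := by
  induction n with
  | zero => simp [chain]
  | succ n ih =>
    rw [chain, ih, ExteriorAlgebra.ιMulti_apply, ExteriorAlgebra.ιMulti_apply, List.ofFn_succ']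
    simp

/-- The coefficient functional of the positions `X`. -/
noncomputable def coef (N : ℕ) (X : Fin N → ℕ) : EA →ₗ[ℂ] ℂ :=
  ExteriorAlgebra.liftAlternating (R := ℂ) (M := (ℕ →₀ ℂ)) (N := ℂ) fun i =>
    if h : i = N then h ▸ (Matrix.detRowAlternating (n := Fin N) (R := ℂ)).compLinearMap
      (LinearMap.pi fun j => Finsupp.lapply (X j)) else 0

lemma coef_chain (N : ℕ) (X : Fin N → ℕ) (f : ℕ → (ℕ →₀ ℂ)) :
    coef N X (chain f N) = Matrix.det (Matrix.of fun i j : Fin N => f i (X j)) := by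
  rw [coef, chain_eq_ιMulti, ExteriorAlgebra.liftAlternating_apply_ιMulti]
  simp only [dif_pos]
  rfl

lemma coef_chain_ne (N n : ℕ) (h : n ≠ N) (X : Fin N → ℕ) (f : ℕ → (ℕ →₀ ℂ)) :
    coef N X (chain f n) = 0 := by
  rw [coef, chain_eq_ιMulti, ExteriorAlgebra.liftAlternating_apply_ιMulti, dif_neg h]
  rfl

lemma ket_eq_chain (S : Finset ℕ) (m : ℕ) : ∃ e : ℕ → ℕ,
    ket S m = chain (fun i => Finsupp.single (e i) 1) (S.filter (· < m)).card ∧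
    (∀ i j, i < j → j < (S.filter (· < m)).card → e i < e j) ∧
    (∀ i < (S.filter (· < m)).card, e i ∈ S ∧ e i < m) := by
  induction m with
  | zero => exact ⟨id, by simp [ket, chain]⟩
  | succ m ih =>
    obtain ⟨e, h1, h2, h3⟩ := ih
    have hc := card_filter_succ S m
    by_cases hm : m ∈ S
    · rw [if_pos hm] at hc
      have hc : (S.filter (· < m + 1)).card = (S.filter (· < m)).card + 1 := by exact_mod_cast hc
      rw [hc]
      generalize (S.filter (· < m)).card = r at *
      refine ⟨Function.update e r m, ?_, ?_, ?_⟩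
      · rw [ket, if_pos hm, h1, chain, Function.update_self]
        congr 1
        exact chain_congr _ _ _ fun i hi => by rw [Function.update_of_ne (by omega)]
      · intro i j hij hj
        rw [Function.update_of_ne (by omega)]
        by_cases hjr : j = r
        · subst hjr; rw [Function.update_self]; exact (h3 i hij).2
        · rw [Function.update_of_ne hjr]; exact h2 i j hij (by omega)
      · intro i hi
        by_cases hir : i = r
        · subst hir; rw [Function.update_self]; exact ⟨hm, by omega⟩
        · rw [Function.update_of_ne hir]
          have := h3 i (by omega)
          exact ⟨this.1, by omega⟩
    · rw [if_neg hm] at hc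
      have hc : (S.filter (· < m + 1)).card = (S.filter (· < m)).card := by exact_mod_cast hc
      rw [hc]
      refine ⟨e, by rw [ket, if_neg hm, h1], h2, fun i hi => ⟨(h3 i hi).1, by have := (h3 i hi).2; omega⟩⟩

lemma coef_ket (N M : ℕ) (X : Fin N → ℕ) (hX : StrictMono X) (S : Finset ℕ) (hS : S ⊆ Finset.range M) :
    coef N X (ket S M) = if S = Finset.univ.image X then 1 else 0 := by
  obtain ⟨e, h1, h2, h3⟩ := ket_eq_chain S M
  have hf : S.filter (· < M) = S := Finset.filter_true_of_mem fun k hk => Finset.mem_range.1 (hS hk)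
  rw [hf] at h1 h2 h3
  rw [h1]
  have hXc : (Finset.univ.image X).card = N := by
    rw [Finset.card_image_of_injective _ hX.injective]; simp
  by_cases hr : S.card = N
  · rw [hr, coef_chain]
    rw [hr] at h2 h3
    have hem : StrictMono (fun i : Fin N => e i) := fun i j hij => h2 i j hij j.2
    have hes : Finset.univ.image (fun i : Fin N => e i) = S := by
      refine Finset.eq_of_subset_of_card_le ?_ ?_
      · intro k hk
        obtain ⟨i, -, rfl⟩ := Finset.mem_image.1 hk
        exact (h3 i i.2).1
      · rw [Finset.card_image_of_injective _ hem.injective, hr]; simp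
    split_ifs with hSX
    · have : (fun i : Fin N => e i) = X := by
        rw [← hem.range_inj hX, ← Set.image_univ, ← Set.image_univ, ← Finset.coe_univ, ← Finset.coe_image, ← Finset.coe_image, hes, hSX]
      have h5 : (Matrix.of fun i j : Fin N => (Finsupp.single (e i) (1:ℂ)) (X j)) = 1 := by
        ext i j
        rw [Matrix.of_apply, show e i = X i from congrFun this i, Finsupp.single_apply, Matrix.one_apply]
        simp only [hX.injective.eq_iff]
      rw [h5, Matrix.det_one]
    · have : ¬ (Finset.univ.image X ⊆ S) := fun h =>
        hSX (Finset.eq_of_subset_of_card_le h (by omega)).symm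
      obtain ⟨k, hk, hkS⟩ := Finset.not_subset.1 this
      obtain ⟨j, -, rfl⟩ := Finset.mem_image.1 hk
      refine Matrix.det_eq_zero_of_column_eq_zero j fun i => ?_
      rw [Matrix.of_apply, Finsupp.single_apply, if_neg]
      intro h; exact hkS (h ▸ (h3 i i.2).1)
  · rw [coef_chain_ne _ _ hr, if_neg]
    rintro rfl
    exact hr hXc

lemma Zf_det (b : ℂ → ℂ) (hodd : ∀ x, b (-x) = - b x) (h1 : b 1 ≠ 0)
    (hAB : ∃ A B : ℂ → ℂ, ∀ x y, b (x + y) * b (x - y) = A x * B y - B x * A y)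
    (a : ℂ) (ha : ∀ k : ℤ, b (a + k) ≠ 0) (w vv : ℕ → ℂ) (M N : ℕ)
    (ht : ∀ j < N, ∀ k < M, b (1 + (w j - vv k)) ≠ 0)
    (hw : ∀ j < N, ∀ i < j, b (w j - w i) ≠ 0)
    (X : Fin N → ℕ) (hX : StrictMono X) (hXM : ∀ j, X j < M) :
    Zf b a w vv M N (Finset.univ.image X) = Kn b a w M N *
      Matrix.det (Matrix.of fun i j : Fin N => Psi b (a + N) (fun k => w i - vv k) M (X j)) := by
  have h := congrArg (coef N X) (Vec_eq b hodd h1 hAB a ha w vv M N ht hw)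
  rw [map_smul, coef_chain, Vec, map_sum, Finset.sum_eq_single (Finset.univ.image X)] at h
  · rw [map_smul, coef_ket N M X hX, if_pos rfl, smul_eq_mul, mul_one, smul_eq_mul] at h
    · exact h
    · intro k hk
      obtain ⟨j, -, rfl⟩ := Finset.mem_image.1 hk
      exact Finset.mem_range.2 (hXM j)
  · intro S hS hne
    rw [map_smul, coef_ket N M X hX S (Finset.mem_powerset.1 hS), if_neg hne, smul_zero]
  · intro hn
    refine absurd (Finset.mem_powerset.2 ?_) hn
    intro k hk
    obtain ⟨j, -, rfl⟩ := Finset.mem_image.1 hk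
    exact Finset.mem_range.2 (hXM j)

end DM

end

section
open Complex Filter Topology

namespace DM

lemma ne_near (b : ℂ → ℂ) (hd : Differentiable ℂ b) (h1 : b 1 ≠ 0) (z : ℂ) :
    ∀ᶠ ε in 𝓝[≠] (0:ℂ), b (z - ε) ≠ 0 := by
  have hg : Differentiable ℂ (fun ε => b (z - ε)) := hd.comp (by fun_prop)
  rcases (hg.analyticAt 0).eventually_eq_zero_or_eventually_ne_zero with h | h
  · exfalso
    have hh : AnalyticOnNhd ℂ (fun ε => b (z - ε)) Set.univ := fun x _ => hg.analyticAt x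
    have h0 : AnalyticOnNhd ℂ (fun _ : ℂ => (0:ℂ)) Set.univ := fun x _ => analyticAt_const
    have := congrFun (hh.eq_of_eventuallyEq h0 h) (z - 1)
    apply h1
    simpa using this
  · exact h

lemma Zf_cont (b : ℂ → ℂ) (hb : Continuous b) (a : ℂ) (w vv : ℕ → ℂ) (M n : ℕ) (S : Finset ℕ) :
    Continuous fun ε => Zf b a w (fun k => vv k + ε) M n S := by
  induction n generalizing S with
  | zero => simp only [Zf]; exact continuous_const
  | succ n ih =>
    simp only [Zf]
    refine continuous_finsetSum _ fun S' _ => (ih S').mul ?_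
    split_ifs
    · refine continuous_finsetProd _ fun k _ => ?_
      simp only [vX]
      split_ifs <;> fun_prop
    · exact continuous_const

lemma Zf_det' (b : ℂ → ℂ) (hd : Differentiable ℂ b) (hodd : ∀ x, b (-x) = - b x) (h1 : b 1 ≠ 0)
    (hAB : ∃ A B : ℂ → ℂ, ∀ x y, b (x + y) * b (x - y) = A x * B y - B x * A y)
    (a : ℂ) (ha : ∀ k : ℤ, b (a + k) ≠ 0) (w vv : ℕ → ℂ) (M N : ℕ)
    (hw : ∀ j < N, ∀ i < j, b (w j - w i) ≠ 0)
    (X : Fin N → ℕ) (hX : StrictMono X) (hXM : ∀ j, X j < M) :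
    Zf b a w vv M N (Finset.univ.image X) = Kn b a w M N *
      Matrix.det (Matrix.of fun i j : Fin N => Psi b (a + N) (fun k => w i - vv k) M (X j)) := by
  have hb := hd.continuous
  have hl := (Zf_cont b hb a w vv M N (Finset.univ.image X)).continuousAt (x := 0)
  have hr : Continuous fun ε : ℂ => Kn b a w M N *
      Matrix.det (Matrix.of fun i j : Fin N => Psi b (a + N) (fun k => w i - (vv k + ε)) M (X j)) := by
    refine continuous_const.mul (Continuous.matrix_det ?_)
    refine continuous_matrix fun i j => ?_
    simp only [Matrix.of_apply, Psi_apply, vac]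
    split_ifs
    · fun_prop
    · exact continuous_const
  have hr := hr.continuousAt (x := 0)
  have hev : ∀ᶠ ε in 𝓝[≠] (0:ℂ), ∀ j ∈ Finset.range N, ∀ k ∈ Finset.range M, b (1 + (w j - (vv k + ε))) ≠ 0 := by
    rw [Filter.eventually_all_finset]
    intro j _
    rw [Filter.eventually_all_finset]
    intro k _
    filter_upwards [ne_near b hd h1 (1 + (w j - vv k))] with ε hε
    rwa [show 1 + (w j - (vv k + ε)) = 1 + (w j - vv k) - ε by ring]
  have := (ContinuousAt.eventuallyEq_nhds_iff_eventuallyEq_nhdsNE hl hr).1 (by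
    filter_upwards [hev] with ε hε
    exact Zf_det b hodd h1 hAB a ha w _ M N
      (fun j hj k hk => hε j (Finset.mem_range.2 hj) k (Finset.mem_range.2 hk)) hw X hX hXM)
  simpa using this.eq_of_nhds

end DM

end

section
open Complex Filter Topology

namespace DM

lemma face_eq (q : ℝ) (lam ω : ℂ) (p : ℤ × ℤ) (d : ℤ) (tp bt : Prop) [Decidable tp] [Decidable bt] (u v : ℂ) :
    faceW q lam ω p (p + if tp then e2 else e1) (p + e1 + d • (e2 - e1))
      (p + e1 + d • (e2 - e1) + if bt then e2 else e1) u v =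
    vX (brak q lam) (aSc ω p) (u - v) d tp bt := by
  obtain ⟨p1, p2⟩ := p
  by_cases h0 : d = 0
  · subst h0
    by_cases h1 : tp <;> by_cases h2 : bt <;> simp [faceW, vX, h1, h2, e1, e2, Prod.ext_iff]
  · by_cases h01 : d = 1
    · subst h01
      by_cases h1 : tp <;> by_cases h2 : bt <;> simp [faceW, vX, h1, h2, e1, e2, Prod.ext_iff]
    · have ha : ∀ z : ℤ × ℤ, ((p1, p2) + e1 + d • (e2 - e1) = (p1, p2) + e1) = False := fun z => by
        simp [e1, e2, Prod.ext_iff]; omega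
      have hb : ∀ z : ℤ × ℤ, ((p1, p2) + e1 + d • (e2 - e1) = (p1, p2) + e2) = False := fun z => by
        simp [e1, e2, Prod.ext_iff]; omega
      rw [faceW, vX, if_neg h0, if_neg h01]
      simp only [ha 0, hb 0, false_and, and_false, if_false]

lemma face_ne (q : ℝ) (lam ω : ℂ) (p b c d : ℤ × ℤ) (u v : ℂ) (h : faceW q lam ω p b c d u v ≠ 0) :
    (b = p + e1 ∨ b = p + e2) ∧ (d = c + e1 ∨ d = c + e2) := by
  unfold faceW at h
  split_ifs at h with h1 h2 h3 h4 h5 h6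
  · exact ⟨Or.inl h1.1, Or.inl (by rw [h1.2.2, h1.2.1])⟩
  · exact ⟨Or.inr h2.1, Or.inr (by rw [h2.2.2, h2.2.1])⟩
  · exact ⟨Or.inr h3.1, Or.inr (by rw [h3.2.2, h3.2.1])⟩
  · exact ⟨Or.inl h4.1, Or.inl (by rw [h4.2.2, h4.2.1]; abel)⟩
  · exact ⟨Or.inl h5.1, Or.inr (by rw [h5.2.2, h5.2.1])⟩
  · exact ⟨Or.inr h6.1, Or.inl (by rw [h6.2.2, h6.2.1]; abel)⟩
  · exact absurd rfl h

lemma transfer_sum {α : Type*} [Fintype α] [DecidableEq α] (T : ℕ → α → α → ℂ) (s0 : α) (z : ℕ → α → ℂ)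
    (h0 : ∀ s, z 0 s = if s = s0 then 1 else 0) (hs : ∀ n s', z (n + 1) s' = ∑ s, z n s * T n s s')
    (n : ℕ) (s' : α) : z n s' = ∑ Y : Fin (n + 1) → α,
      if Y 0 = s0 ∧ Y (Fin.last n) = s' then ∏ i : Fin n, T i (Y i.castSucc) (Y i.succ) else 0 := by
  induction n generalizing s' with
  | zero =>
    rw [h0, ← (Equiv.funUnique (Fin 1) α).symm.sum_comp]
    simp only [Equiv.funUnique_symm_apply, Finset.univ_eq_empty, Finset.prod_empty, uniqueElim_const]
    by_cases h : s' = s0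
    · subst h; simp
    · rw [if_neg h, Finset.sum_eq_zero]
      intro x _
      rw [if_neg]
      rintro ⟨rfl, rfl⟩
      exact h rfl
  | succ n ih =>
    rw [hs, ← (Fin.snocEquiv (fun _ : Fin (n + 2) => α)).sum_comp, Fintype.sum_prod_type]
    refine Eq.trans ?_ (Finset.sum_eq_single s' ?_ ?_).symm
    · simp only [ih, Finset.sum_mul]
      rw [Finset.sum_comm]
      refine Finset.sum_congr rfl fun Y _ => ?_
      rw [Finset.sum_eq_single (Y (Fin.last n))]
      · have e0 : (Fin.snocEquiv (fun _ : Fin (n + 2) => α)) (s', Y) 0 = Y 0 := by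
          show Fin.snoc (α := fun _ => α) Y s' (Fin.castSucc 0) = _
          rw [Fin.snoc_castSucc]
        have e1 : (Fin.snocEquiv (fun _ : Fin (n + 2) => α)) (s', Y) (Fin.last _) = s' := by
          show Fin.snoc (α := fun _ => α) Y s' (Fin.last _) = _
          rw [Fin.snoc_last]
        have e2 : ∀ i : Fin (n + 1), (Fin.snocEquiv (fun _ : Fin (n + 2) => α)) (s', Y) i.castSucc = Y i := fun i => by
          show Fin.snoc (α := fun _ => α) Y s' (Fin.castSucc i) = _
          rw [Fin.snoc_castSucc]
        rw [e0, e1, Fin.prod_univ_castSucc]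
        simp only [e2, Fin.succ_last, e1, and_true, ite_mul, zero_mul]
        refine if_congr Iff.rfl ?_ rfl
        congr 1
        refine Finset.prod_congr rfl fun i _ => ?_
        rw [Fin.succ_castSucc, e2]
        rfl
      · intro s _ hs
        rw [if_neg (fun h => hs h.2.symm), zero_mul]
      · intro h; exact absurd (Finset.mem_univ _) h
    · intro s _ hs
      refine Finset.sum_eq_zero fun Y _ => ?_
      rw [if_neg]
      rintro ⟨-, h⟩
      apply hs
      rw [← h]
      show _ = Fin.snoc (α := fun _ => α) Y s (Fin.last _)
      rw [Fin.snoc_last]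
    · intro h; exact absurd (Finset.mem_univ _) h

end DM

end

section
open Complex Filter Topology

namespace DM

/-- Subsets of the set of columns. -/
abbrev PM (M : ℕ) := {S : Finset ℕ // S ∈ (Finset.range M).powerset}

/-- Number of particles left of `k`. -/
def cnt (S : Finset ℕ) (k : ℕ) : ℤ := (S.filter (· < k)).card

lemma cnt_succ (S : Finset ℕ) (k : ℕ) : cnt S (k + 1) = cnt S k + if k ∈ S then 1 else 0 :=
  card_filter_succ S k

lemma cnt_zero (S : Finset ℕ) : cnt S 0 = 0 := by simp [cnt]

lemma dd_eq (S S' : Finset ℕ) (k : ℕ) : dd S S' k = cnt S' k - cnt S k := rfl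

lemma cnt_inj (S S' : Finset ℕ) (M : ℕ) (hS : S ⊆ Finset.range M) (hS' : S' ⊆ Finset.range M)
    (h : ∀ k ≤ M, cnt S k = cnt S' k) : S = S' := by
  ext k
  by_cases hk : k < M
  · have h1 := h (k + 1) (by omega)
    rw [cnt_succ, cnt_succ, h k (by omega)] at h1
    by_cases h2 : k ∈ S <;> by_cases h3 : k ∈ S' <;> simp [h2, h3] at h1 ⊢
  · exact ⟨fun h => absurd (Finset.mem_range.1 (hS h)) hk, fun h => absurd (Finset.mem_range.1 (hS' h)) hk⟩

/-- The height configuration of a sequence of particle configurations. -/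
def Phi (N M : ℕ) (a : ℤ × ℤ) (Y : Fin (N + 1) → PM M) : Fin (N + 1) × Fin (M + 1) → ℤ × ℤ :=
  fun p => (a.1 + ((p.1 : ℕ) : ℤ) + ((p.2 : ℕ) : ℤ) - cnt (Y p.1) p.2, a.2 + cnt (Y p.1) p.2)

lemma Phi_inj (N M : ℕ) (a : ℤ × ℤ) : Function.Injective (Phi N M a) := by
  intro Y Y' h
  funext i
  refine Subtype.ext (cnt_inj _ _ M (Finset.mem_powerset.1 (Y i).2) (Finset.mem_powerset.1 (Y' i).2) fun k hk => ?_)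
  have := congrArg Prod.snd (congrFun h (i, ⟨k, by omega⟩))
  simpa [Phi] using this

lemma path_of (M : ℕ) (r : ℕ → ℤ × ℤ) (h : ∀ k < M, r (k + 1) = r k + e1 ∨ r (k + 1) = r k + e2) :
    ∃ S : PM M, ∀ k ≤ M, r k = ((r 0).1 + k - cnt S k, (r 0).2 + cnt S k) := by
  classical
  refine ⟨⟨(Finset.range M).filter fun k => r (k + 1) = r k + e2, Finset.mem_powerset.2 (Finset.filter_subset _ _)⟩, ?_⟩
  intro k hk
  induction k with
  | zero => simp [cnt_zero]
  | succ k ih =>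
    have ih := ih (by omega)
    rw [cnt_succ]
    simp only [Finset.mem_filter, Finset.mem_range, show k < M by omega, true_and]
    generalize cnt _ k = c at *
    by_cases h2 : r (k + 1) = r k + e2
    · rw [if_pos h2, h2]
      conv_lhs => rw [ih]
      simp [e2, Prod.ext_iff]
      constructor <;> ring
    · rw [if_neg h2, (h k (by omega)).resolve_right h2]
      conv_lhs => rw [ih]
      simp [e1, Prod.ext_iff]
      ring

lemma Phi_surj (N M : ℕ) (hN : 1 ≤ N) (q : ℝ) (lam ω : ℂ) (U V : ℕ → ℂ) (a : ℤ × ℤ)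
    (s : Fin (N + 1) × Fin (M + 1) → ℤ × ℤ) (hl : ∀ i : Fin (N + 1), s (i, 0) = a + ((i : ℕ) : ℤ) • e1)
    (hs : ∀ (i : Fin N) (k : Fin M), faceW q lam ω (s (i.castSucc, k.castSucc)) (s (i.castSucc, k.succ))
          (s (i.succ, k.castSucc)) (s (i.succ, k.succ)) (U i) (V k) ≠ 0) :
    s ∈ Set.range (Phi N M a) := by
  have hst : ∀ (i : Fin (N + 1)) (k : Fin M), s (i, k.succ) = s (i, k.castSucc) + e1 ∨
      s (i, k.succ) = s (i, k.castSucc) + e2 := by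
    intro i k
    rcases Fin.eq_castSucc_or_eq_last i with ⟨j, rfl⟩ | rfl
    · exact (face_ne _ _ _ _ _ _ _ _ _ (hs j k)).1
    · obtain ⟨n, rfl⟩ : ∃ n, N = n + 1 := ⟨N - 1, by omega⟩
      have := (face_ne _ _ _ _ _ _ _ _ _ (hs (Fin.last n) k)).2
      rwa [Fin.succ_last] at this
  have : ∀ i : Fin (N + 1), ∃ S : PM M, ∀ k : Fin (M + 1),
      s (i, k) = (a.1 + ((i : ℕ) : ℤ) + ((k : ℕ) : ℤ) - cnt S k, a.2 + cnt S k) := by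
    intro i
    obtain ⟨S, hS⟩ := path_of M (fun k => if h : k < M + 1 then s (i, ⟨k, h⟩) else 0) (by
      intro k hk
      have := hst i ⟨k, hk⟩
      rw [dif_pos (by omega), dif_pos (by omega)]
      exact this)
    refine ⟨S, fun k => ?_⟩
    have h := hS k (by omega)
    rw [dif_pos k.2, dif_pos (by omega)] at h
    have h0 : s (i, ⟨0, by omega⟩) = _ := hl i
    rw [h0] at h
    rw [show s (i, k) = _ from h]
    simp [e1]
  choose Y hY using this
  exact ⟨Y, by funext p; exact (hY p.1 p.2).symm⟩

lemma prod_dd (N M : ℕ) (Y : Fin (N + 1) → PM M) (h0 : (Y 0).1 = ∅)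
    (h : ∀ i : Fin N, dd (Y i.castSucc) (Y i.succ) M = 1) (i : Fin (N + 1)) : cnt (Y i) M = ((i : ℕ) : ℤ) := by
  induction i using Fin.induction with
  | zero => simp [h0, cnt]
  | succ i ih =>
    have := h i
    rw [dd_eq, ih] at this
    rw [Fin.val_castSucc] at this
    rw [Fin.val_succ]
    push_cast; linarith

end DM

end

section
open Complex Filter Topology

namespace DM

lemma Phi_face (N M : ℕ) (q : ℝ) (lam ω : ℂ) (a : ℤ × ℤ) (Y : Fin (N + 1) → PM M) (i : Fin N) (k : Fin M) (U V : ℂ) :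
    faceW q lam ω (Phi N M a Y (i.castSucc, k.castSucc)) (Phi N M a Y (i.castSucc, k.succ))
          (Phi N M a Y (i.succ, k.castSucc)) (Phi N M a Y (i.succ, k.succ)) U V =
    vX (brak q lam) (aSc ω a + ((i : ℕ) : ℂ) + ((k : ℕ) : ℂ)) (U - V)
      (dd (Y i.castSucc) (Y i.succ) k) ((k : ℕ) ∈ (Y i.castSucc).1) ((k : ℕ) ∈ (Y i.succ).1) := by
  have h := face_eq q lam ω (Phi N M a Y (i.castSucc, k.castSucc)) (dd (Y i.castSucc) (Y i.succ) k)
    ((k : ℕ) ∈ (Y i.castSucc).1) ((k : ℕ) ∈ (Y i.succ).1) U V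
  have hA : aSc ω (Phi N M a Y (i.castSucc, k.castSucc)) = aSc ω a + ((i : ℕ) : ℂ) + ((k : ℕ) : ℂ) := by
    simp [aSc, Phi]; ring
  have hb : Phi N M a Y (i.castSucc, k.succ) = Phi N M a Y (i.castSucc, k.castSucc) +
      if (k : ℕ) ∈ (Y i.castSucc).1 then e2 else e1 := by
    simp only [Phi, Fin.val_castSucc, Fin.val_succ, cnt_succ]
    split_ifs <;> simp [e1, e2, Prod.ext_iff] <;> (try constructor) <;> ring
  have hc : Phi N M a Y (i.succ, k.castSucc) = Phi N M a Y (i.castSucc, k.castSucc) + e1 +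
      (dd (Y i.castSucc) (Y i.succ) k) • (e2 - e1) := by
    simp only [Phi, Fin.val_castSucc, Fin.val_succ, dd_eq]
    simp [e1, e2, Prod.ext_iff]
    ring
  have hd : Phi N M a Y (i.succ, k.succ) = Phi N M a Y (i.succ, k.castSucc) +
      if (k : ℕ) ∈ (Y i.succ).1 then e2 else e1 := by
    simp only [Phi, Fin.val_castSucc, Fin.val_succ, cnt_succ]
    split_ifs <;> simp [e1, e2, Prod.ext_iff] <;> (try constructor) <;> ring
  rw [hd, hb, hc, h, hA]

lemma partW_eq (q : ℝ) (lam ω : ℂ) (M N : ℕ) (hN : 1 ≤ N) (u v : ℕ → ℂ) (x : ℕ → ℕ) (a : ℤ × ℤ)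
    (Sx : Finset ℕ) (hSx : Sx ∈ (Finset.range M).powerset) (hx : ∀ k ≤ M, (btmCount N x k : ℤ) = cnt Sx k) :
    partW q lam ω M N u v x a =
      Zf (brak q lam) (aSc ω a) (fun i => u (N - i)) (fun k => v (k + 1)) M N Sx := by
  classical
  have hz := transfer_sum (α := PM M) (fun n S S' => if dd S S' M = 1 then
      Rw (brak q lam) (fun k => aSc ω a + n + k) (fun k => u (N - n) - v (k + 1)) S S' M else 0)
    ⟨∅, Finset.empty_mem_powerset _⟩
    (fun n S => Zf (brak q lam) (aSc ω a) (fun i => u (N - i)) (fun k => v (k + 1)) M n S)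
    (fun s => by simp [Zf, Subtype.ext_iff])
    (fun n s' => by
      simp only [Zf]
      exact (Finset.sum_coe_sort ((Finset.range M).powerset) (fun S => Zf (brak q lam) (aSc ω a) (fun i => u (N - i)) (fun k => v (k + 1)) M n S *
        if dd S s' M = 1 then
      Rw (brak q lam) (fun k => aSc ω a + n + k) (fun k => u (N - n) - v (k + 1)) S s' M else 0)).symm)
    N ⟨Sx, hSx⟩
  rw [show Zf (brak q lam) (aSc ω a) (fun i => u (N - i)) (fun k => v (k + 1)) M N Sx = _ from hz]
  unfold partW
  rw [← (Phi_inj N M a).tsum_eq, tsum_fintype]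
  · refine Finset.sum_congr rfl fun Y _ => ?_
    have c1 : (∀ k : Fin (M + 1), Phi N M a Y (0, k) = a + ((k : ℕ) : ℤ) • e1) ↔ (Y 0).1 = ∅ := by
      constructor
      · intro h
        refine cnt_inj _ _ M (Finset.mem_powerset.1 (Y 0).2) (Finset.empty_subset _) fun k hk => ?_
        have := congrArg Prod.snd (h ⟨k, by omega⟩)
        simp [Phi, e1] at this
        simpa [cnt] using this
      · intro h k
        simp [Phi, h, cnt, e1, Prod.ext_iff]
    have c2 : ∀ i : Fin (N + 1), Phi N M a Y (i, 0) = a + ((i : ℕ) : ℤ) • e1 := by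
      intro i
      simp [Phi, cnt_zero, e1, Prod.ext_iff]
    have c3 : (∀ i : Fin (N + 1), Phi N M a Y (i, Fin.last M) = a + (M : ℤ) • e1 + ((i : ℕ) : ℤ) • e2) ↔
        ∀ i, cnt (Y i) M = ((i : ℕ) : ℤ) := by
      refine forall_congr' fun i => ?_
      simp [Phi, e1, e2, Prod.ext_iff]
      intro h; rw [h]; ring
    have c4 : (∀ k : Fin (M + 1), Phi N M a Y (Fin.last N, k) =
          a + ((N : ℤ) + ((k : ℕ) : ℤ) - (btmCount N x (k : ℕ) : ℤ)) • e1 +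
            (btmCount N x (k : ℕ) : ℤ) • e2) ↔ Y (Fin.last N) = ⟨Sx, hSx⟩ := by
      constructor
      · intro h
        refine Subtype.ext (cnt_inj _ _ M (Finset.mem_powerset.1 (Y _).2) (Finset.mem_powerset.1 hSx) fun k hk => ?_)
        have := congrArg Prod.snd (h ⟨k, by omega⟩)
        simp [Phi, e1, e2] at this
        rw [this, hx k hk]
      · intro h k
        rw [hx k (by omega)]
        simp [Phi, h, e1, e2, Prod.ext_iff]
        ring
    by_cases h0 : (Y 0).1 = ∅
    · by_cases h4 : Y (Fin.last N) = ⟨Sx, hSx⟩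
      · rw [if_pos (show Y 0 = _ ∧ _ from ⟨Subtype.ext h0, h4⟩)]
        by_cases h3 : ∀ i, cnt (Y i) M = ((i : ℕ) : ℤ)
        · rw [if_pos ⟨c1.2 h0, c2, c3.2 h3, c4.2 h4⟩]
          refine Finset.prod_congr rfl fun i _ => ?_
          rw [if_pos (by rw [dd_eq, h3, h3]; simp), Rw, Finset.prod_range]
          refine Finset.prod_congr rfl fun k _ => ?_
          rw [Phi_face]
        · rw [if_neg (fun h => h3 (c3.1 h.2.2.1))]
          have : ∃ i : Fin N, dd (Y i.castSucc) (Y i.succ) M ≠ 1 := by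
            by_contra hcon
            push Not at hcon
            exact h3 (prod_dd N M Y h0 hcon)
          obtain ⟨i, hi⟩ := this
          exact (Finset.prod_eq_zero (Finset.mem_univ i) (if_neg hi)).symm
      · rw [if_neg (fun h => h4 (c4.1 h.2.2.2)), if_neg (fun h => h4 h.2)]
    · rw [if_neg (fun h => h0 (c1.1 h.1)), if_neg (fun h => h0 (congrArg Subtype.val h.1))]
  · intro s hs
    rw [Function.mem_support] at hs
    split_ifs at hs with hc
    · refine Phi_surj N M hN q lam ω (fun i => u (N - i)) (fun k => v (k + 1)) a s hc.2.1 fun i k => ?_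
      exact Finset.prod_ne_zero_iff.1 (Finset.prod_ne_zero_iff.1 hs i (Finset.mem_univ _)) k (Finset.mem_univ _)
    · exact absurd rfl hs

end DM

end

section
open Complex Filter Topology

namespace DM

lemma prod_shift (g : ℕ → ℂ) (hg : ∀ n, g n ≠ 0) (c p r : ℕ) (h : p ≤ r) :
    ∏ j ∈ Finset.Ico p r, g (j + c) = (∏ z ∈ Finset.range (r + c), g z) / ∏ z ∈ Finset.range (p + c), g z := by
  have hA : ∀ n, ∏ z ∈ Finset.range n, g z ≠ 0 := fun n => Finset.prod_ne_zero_iff.2 fun z _ => hg z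
  induction r, h using Nat.le_induction with
  | base => simp [div_self (hA _)]
  | succ r hr ih =>
    rw [Finset.prod_Ico_succ_top hr, ih, show r + 1 + c = r + c + 1 by ring, Finset.prod_range_succ]
    ring

lemma pref_eq (g : ℕ → ℂ) (hg : ∀ n, g n ≠ 0) (X : ℕ → ℕ) (M N : ℕ)
    (hX : ∀ k, 1 ≤ k → k ≤ N → X k < X (k + 1)) (hX1 : ∀ k, 1 ≤ k → k ≤ N → 1 ≤ X k) (hXN : X (N + 1) = M + 1) :
    ∏ k ∈ Finset.Icc 1 N, ∏ j ∈ Finset.Icc (X k) (X (k + 1) - 2), g (j + N) / g (j + N - k) =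
      (∏ i ∈ Finset.range N, g (M + i)) / ∏ k ∈ Finset.Icc 1 N, g (N + X k - 1) := by
  have hA : ∀ n, ∏ z ∈ Finset.range n, g z ≠ 0 := fun n => Finset.prod_ne_zero_iff.2 fun z _ => hg z
  set A : ℕ → ℂ := fun n => ∏ z ∈ Finset.range n, g z with hAdef
  have hA' : ∀ n, A n ≠ 0 := hA
  have hterm : ∀ k, 1 ≤ k → k ≤ N → ∏ j ∈ Finset.Icc (X k) (X (k + 1) - 2), g (j + N) / g (j + N - k) =
      (A (N + X (k + 1) - 1) / A (N + X (k + 1) - (k + 1))) / (A (N + X k - 1) / A (N + X k - k)) / g (N + X k - 1) := by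
    intro k hk1 hkN
    have h1 := hX k hk1 hkN
    have h2 := hX1 k hk1 hkN
    rw [show Finset.Icc (X k) (X (k + 1) - 2) = Finset.Ico (X k) (X (k + 1) - 1) by
      ext j; simp only [Finset.mem_Icc, Finset.mem_Ico]; omega]
    rw [Finset.prod_div_distrib, prod_shift g hg N _ _ (by omega)]
    rw [show ∏ j ∈ Finset.Ico (X k) (X (k + 1) - 1), g (j + N - k) =
      ∏ j ∈ Finset.Ico (X k) (X (k + 1) - 1), g (j + (N - k)) from
        Finset.prod_congr rfl fun j _ => by rw [Nat.add_sub_assoc hkN], prod_shift g hg (N - k) _ _ (by omega)]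
    have e : A (X k + N) = A (N + X k - 1) * g (N + X k - 1) := by
      have h3 : X k + N = N + X k - 1 + 1 := by omega
      rw [h3]
      exact Finset.prod_range_succ _ _
    show A _ / A _ / (A _ / A _) = _
    rw [e, show X (k + 1) - 1 + N = N + X (k + 1) - 1 by omega,
      show X (k + 1) - 1 + (N - k) = N + X (k + 1) - (k + 1) by omega,
      show X k + (N - k) = N + X k - k by omega]
    have := hA' (N + X k - 1)
    have := hA' (N + X k - k)
    have := hA' (N + X (k + 1) - 1)
    have := hA' (N + X (k + 1) - (k + 1))
    have := hg (N + X k - 1)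
    field_simp
  have htel : ∀ n ≤ N, ∏ k ∈ Finset.Icc 1 n, ∏ j ∈ Finset.Icc (X k) (X (k + 1) - 2), g (j + N) / g (j + N - k) =
      (A (N + X (n + 1) - 1) / A (N + X (n + 1) - (n + 1))) / ∏ k ∈ Finset.Icc 1 n, g (N + X k - 1) := by
    intro n hn
    induction n with
    | zero =>
      simp [div_self (hA' _)]
    | succ n ih =>
      rw [Finset.prod_Icc_succ_top (by omega), Finset.prod_Icc_succ_top (by omega), ih (by omega),
        hterm (n + 1) (by omega) hn]
      have := hA' (N + X (n + 1) - 1)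
      have := hA' (N + X (n + 1) - (n + 1))
      field_simp
  rw [htel N le_rfl, hXN]
  congr 1
  rw [show N + (M + 1) - 1 = M + N by omega, show N + (M + 1) - (N + 1) = M by omega]
  rw [div_eq_iff (hA' _)]
  show ∏ z ∈ Finset.range (M + N), g z = _ * ∏ z ∈ Finset.range M, g z
  rw [Finset.prod_range_add, mul_comm]

end DM

end

section
open Complex Filter Topology

namespace DM

/-- Product over ordered pairs. -/
noncomputable def PP (N : ℕ) (f : Fin N → Fin N → ℂ) : ℂ :=
  ∏ j : Fin N, ∏ k : Fin N, if (j : ℕ) < (k : ℕ) then f j k else 1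

lemma PP_div (N : ℕ) (f g : Fin N → Fin N → ℂ) : PP N (fun i j => f i j / g i j) = PP N f / PP N g := by
  simp only [PP]
  rw [← Finset.prod_div_distrib]
  refine Finset.prod_congr rfl fun i _ => ?_
  rw [← Finset.prod_div_distrib]
  refine Finset.prod_congr rfl fun j _ => ?_
  split_ifs <;> simp

lemma PP_ne (N : ℕ) (f : Fin N → Fin N → ℂ) (h : ∀ i j : Fin N, i < j → f i j ≠ 0) : PP N f ≠ 0 := by
  refine Finset.prod_ne_zero_iff.2 fun i _ => Finset.prod_ne_zero_iff.2 fun j _ => ?_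
  split_ifs with hij
  · exact h i j hij
  · exact one_ne_zero

lemma PP_Iio (N : ℕ) (f : Fin N → Fin N → ℂ) : ∏ j : Fin N, ∏ i ∈ Finset.Iio j, f i j = PP N f := by
  rw [PP, Finset.prod_comm]
  refine Finset.prod_congr rfl fun j _ => ?_
  rw [← Finset.prod_filter]
  refine Finset.prod_congr ?_ fun _ _ => rfl
  ext i
  simp

lemma PP_rev (N : ℕ) (f : Fin N → Fin N → ℂ) : PP N (fun i j => f j.rev i.rev) = PP N f := by
  simp only [PP]
  rw [Finset.prod_comm, ← Equiv.prod_comp Fin.revPerm]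
  refine Finset.prod_congr rfl fun i _ => ?_
  rw [← Equiv.prod_comp Fin.revPerm]
  refine Finset.prod_congr rfl fun j _ => ?_
  simp only [Fin.revPerm_apply, Fin.rev_rev]
  refine if_congr ?_ rfl rfl
  exact Fin.rev_lt_rev

lemma PP_perm (N : ℕ) (σ : Equiv.Perm (Fin N)) (f : Fin N → Fin N → ℂ) (hf : ∀ i j, f i j = - f j i) :
    PP N (fun i j => f (σ i) (σ j)) = ((Equiv.Perm.sign σ : ℤ) : ℂ) * PP N f := by
  rw [← PP_Iio, ← PP_Iio]
  exact Equiv.Perm.prod_Iio_comp_eq_sign_mul_prod σ hf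

lemma Kn_eq (b : ℂ → ℂ) (a : ℂ) (w : ℕ → ℂ) (M N : ℕ) : Kn b a w M N =
    (∏ j ∈ Finset.range N, b (a + j + M)) *
      PP N (fun i j => b (1 - (w j - w i)) / b (-(w j - w i))) := by
  rw [Kn, Finset.prod_mul_distrib, ← PP_Iio]
  congr 1
  rw [Finset.prod_range]
  refine Finset.prod_congr rfl fun j _ => ?_
  rw [← Nat.Iio_eq_range, ← Fin.map_valEmbedding_Iio, Finset.prod_map]
  rfl

lemma Psi_term (b : ℂ → ℂ) (a U : ℂ) (v : ℕ → ℂ) (M N x : ℕ) (hx : 1 ≤ x) (hxM : x ≤ M) :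
    Psi b (a + N) (fun k => U - v (k + 1)) M (x - 1) =
      (∏ k ∈ Finset.Icc (x + 1) M, b (U - v k) / b 1) *
      (b (-U + v x + a + x + N - 2) / b (a + x + N - 2)) *
      (∏ k ∈ Finset.Icc 1 (x - 1), b (1 + U - v k) / b 1) / b (a + (N + x - 1 : ℕ)) := by
  obtain ⟨y, rfl⟩ : ∃ y, x = y + 1 := ⟨x - 1, by omega⟩
  rw [Psi_apply, if_pos (by omega), vac]
  simp only [Nat.add_sub_cancel, ← Nat.add_assoc]
  rw [Finset.prod_Ico_add' (fun k => b (U - v k) / b 1) (y + 1) M 1,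
    show Finset.Ico (y + 1 + 1) (M + 1) = Finset.Icc (y + 1 + 1) M by
      ext j; simp only [Finset.mem_Icc, Finset.mem_Ico]; omega]
  have h2 : ∏ k ∈ Finset.range y, b (1 + (U - v (k + 1))) / b 1 = ∏ k ∈ Finset.Icc 1 y, b (1 + U - v k) / b 1 := by
    rw [Finset.range_eq_Ico, Finset.prod_Ico_add' (fun k => b (1 + (U - v k)) / b 1) 0 y 1]
    refine Finset.prod_congr ?_ fun k _ => by rw [add_sub_assoc]
    ext j; simp only [Finset.mem_Icc, Finset.mem_Ico]; omega
  rw [h2]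
  push_cast
  rw [show a + (N : ℂ) + y - 1 - (U - v (y + 1)) = -U + v (y + 1) + a + (y + 1) + N - 2 by ring,
    show a + (N : ℂ) + y - 1 = a + (y + 1) + N - 2 by ring, show a + ((N : ℂ) + y) = a + N + y by ring]
  ring

lemma ellG_eq (q : ℝ) (lam : ℂ) (M N : ℕ) (u v : ℕ → ℂ) (x : ℕ → ℕ) (a : ℂ)
    (hodd : ∀ z, brak q lam (-z) = - brak q lam z)
    (h1 : brak q lam 1 ≠ 0) (ha : ∀ k : ℤ, brak q lam (a + k) ≠ 0)
    (hu : ∀ j k, 1 ≤ j → j ≤ N → 1 ≤ k → k ≤ N → j ≠ k → brak q lam (u j - u k) ≠ 0)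
    (hx1 : ∀ j, 1 ≤ j → j ≤ N → 1 ≤ x j)
    (hxmono : ∀ j k, 1 ≤ j → j < k → k ≤ N → x j < x k)
    (hxM : ∀ j, 1 ≤ j → j ≤ N → x j ≤ M) :
    Kn (brak q lam) a (fun i => u (N - i)) M N *
      Matrix.det (Matrix.of fun i j : Fin N => Psi (brak q lam) (a + N) (fun k => u (N - i) - v (k + 1)) M
        (x ((j : ℕ) + 1) - 1)) = ellG q lam M N u v x a := by
  have hpref : (∏ k ∈ Finset.Icc 1 N, ∏ j ∈ Finset.Icc (xM M N x k) (xM M N x (k + 1) - 2),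
      brak q lam (a + (j : ℂ) + (N : ℂ)) / brak q lam (a + (j : ℂ) + (N : ℂ) - (k : ℂ))) =
      (∏ j ∈ Finset.range N, brak q lam (a + j + M)) / ∏ j : Fin N, brak q lam (a + (N + x ((j : ℕ) + 1) - 1 : ℕ)) := by
    have h := pref_eq (fun n => brak q lam (a + n)) (fun n => by exact_mod_cast ha n) (xM M N x) M N
      (by
        intro k hk hkN
        unfold xM
        rw [if_neg (by omega)]
        split_ifs with h
        · have := hxM k hk hkN; omega
        · exact hxmono k (k + 1) hk (by omega) (by omega))
      (by
        intro k hk hkN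
        unfold xM
        rw [if_neg (by omega)]
        exact hx1 k hk hkN)
      (by simp [xM])
    refine Eq.trans ?_ (h.trans ?_)
    · refine Finset.prod_congr rfl fun k hk => Finset.prod_congr rfl fun j _ => ?_
      have hkN := (Finset.mem_Icc.1 hk).2
      rw [Nat.cast_sub (by omega)]
      push_cast
      rw [add_assoc a, ← add_sub_assoc]
    · congr 1
      · refine Finset.prod_congr rfl fun k _ => ?_
        push_cast
        rw [add_assoc, add_comm (k : ℂ)]
      · rw [← Finset.prod_range (fun j => brak q lam (a + (N + x (j + 1) - 1 : ℕ))), Finset.range_eq_Ico,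
          Finset.prod_Ico_add' (fun j => brak q lam (a + (N + x j - 1 : ℕ))) 0 N 1]
        refine Finset.prod_congr ?_ fun k hk => ?_
        · ext j; simp only [Finset.mem_Icc, Finset.mem_Ico]; omega
        · rw [xM, if_neg]
          have := (Finset.mem_Ico.1 hk).2
          omega
  have hw : ∀ i : Fin N, u (N - i) = u ((i.rev : ℕ) + 1) := fun i => by
    congr 1; rw [Fin.val_rev]; omega
  have hne : ∀ i j : Fin N, i ≠ j → brak q lam (u ((i : ℕ) + 1) - u ((j : ℕ) + 1)) ≠ 0 := fun i j hij =>
    hu _ _ (by omega) (by omega) (by omega) (by omega) (fun h => hij (Fin.ext (by omega)))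
  set c1 := PP N (fun _ _ => brak q lam 1) with hc1
  have hc1' : c1 ≠ 0 := PP_ne _ _ fun _ _ _ => h1
  set num := PP N (fun j k => brak q lam (1 + u ((k : ℕ) + 1) - u ((j : ℕ) + 1))) with hnum
  have hnumeq : PP N (fun j k => brak q lam (1 + u ((k : ℕ) + 1) - u ((j : ℕ) + 1)) / brak q lam 1) = num / c1 :=
    PP_div _ _ _
  set D := PP N (fun i j => brak q lam (u ((i.rev : ℕ) + 1) - u ((j.rev : ℕ) + 1))) with hD
  have hD0 : D ≠ 0 := PP_ne _ _ fun i j hij => hne _ _ (fun h => hij.ne (Fin.rev_injective h))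
  have hKn : Kn (brak q lam) a (fun i => u (N - i)) M N =
      (∏ j ∈ Finset.range N, brak q lam (a + j + M)) * (num / D) := by
    rw [Kn_eq, PP_div, hnum, ← PP_rev N (fun j k => brak q lam (1 + u ((k : ℕ) + 1) - u ((j : ℕ) + 1))), hD]
    simp only [hw]
    congr 3 <;> (ext i j; congr 1; ring)
  have hden : ∀ σ : Equiv.Perm (Fin N), PP N (fun j k => brak q lam 1 /
      brak q lam (u ((((σ.trans Fin.revPerm) j : Fin N) : ℕ) + 1) - u ((((σ.trans Fin.revPerm) k : Fin N) : ℕ) + 1))) =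
      c1 * (((Equiv.Perm.sign σ : ℤ) : ℂ) / D) := by
    intro σ
    rw [PP_div]
    have := PP_perm N σ (fun i j => brak q lam (u ((i.rev : ℕ) + 1) - u ((j.rev : ℕ) + 1)))
      (fun i j => by rw [← hodd]; congr 1; ring)
    simp only [Equiv.trans_apply, Fin.revPerm_apply]
    rw [this, ← hc1, ← hD]
    rcases Int.units_eq_one_or (Equiv.Perm.sign σ) with h | h <;> rw [h] <;> push_cast <;> field_simp
  have hE : ∏ j : Fin N, brak q lam (a + (N + x ((j : ℕ) + 1) - 1 : ℕ)) ≠ 0 :=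
    Finset.prod_ne_zero_iff.2 fun j _ => by exact_mod_cast ha (N + x ((j : ℕ) + 1) - 1 : ℕ)
  rw [ellG, ellE, hpref, hKn, Matrix.det_apply']
  rw [show (∏ j : Fin N, ∏ k : Fin N,
      if (j : ℕ) < (k : ℕ) then
        brak q lam (1 + u ((k : ℕ) + 1) - u ((j : ℕ) + 1)) / brak q lam 1
      else 1) = _ from hnumeq]
  conv_rhs => rw [← Equiv.sum_comp (Equiv.mulLeft (Fin.revPerm : Equiv.Perm (Fin N)))]
  rw [Finset.mul_sum, Finset.mul_sum, Finset.mul_sum]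
  refine Finset.sum_congr rfl fun σ _ => ?_
  rw [show (Equiv.mulLeft (Fin.revPerm : Equiv.Perm (Fin N))) σ = σ.trans Fin.revPerm from rfl]
  rw [show (∏ j : Fin N, ∏ k : Fin N,
        if (j : ℕ) < (k : ℕ) then
          brak q lam 1 / brak q lam (u ((((σ.trans Fin.revPerm) j : Fin N) : ℕ) + 1) - u ((((σ.trans Fin.revPerm) k : Fin N) : ℕ) + 1))
        else 1) = _ from hden σ]
  simp only [Matrix.of_apply]
  rw [Finset.prod_congr rfl fun j _ => Psi_term (brak q lam) a (u (N - (σ j : ℕ))) v M N (x ((j : ℕ) + 1))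
    (hx1 _ (by omega) (by omega)) (hxM _ (by omega) (by omega))]
  rw [Finset.prod_div_distrib, Finset.prod_mul_distrib, Finset.prod_mul_distrib]
  simp only [hw, Equiv.trans_apply, Fin.revPerm_apply]
  generalize (∏ j : Fin N, brak q lam (a + (N + x ((j : ℕ) + 1) - 1 : ℕ))) = E at *
  field_simp

end DM

end

/-- Main theorem: the partition functions of the Deguchi–Martin model are
given explicitly by
`W_{M,N}(u₁,…,u_N|v₁,…,v_M|x₁,…,x_N|a₁₂)
  = ∏_{1≤j<k≤N}([1+u_k-u_j]/[1]) · E_{M,N}(u₁,…,u_N|v₁,…,v_M|x₁,…,x_N|a₁₂)`,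
i.e. `W_{M,N} = G_{M,N}`. -/
theorem statement12 (q : ℝ) (hq0 : 0 < q) (hq1 : q < 1) (lam : ℂ) (hlam : lam ≠ 0)
    (ω12 : ℂ) (M N : ℕ) (hN : 1 ≤ N) (hNM : N ≤ M)
    (u v : ℕ → ℂ) (x : ℕ → ℕ)
    (hx1 : 1 ≤ x 1) (hxmono : ∀ j k, 1 ≤ j → j < k → k ≤ N → x j < x k)
    (hxN : x N ≤ M) (a : ℤ × ℤ)
    (hbr1 : brak q lam 1 ≠ 0)
    (hbrA : ∀ b : ℤ × ℤ, brak q lam (aSc ω12 b) ≠ 0)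
    (hbrA' : ∀ b : ℤ × ℤ, brak q lam (-aSc ω12 b) ≠ 0)
    (hu : ∀ j k, 1 ≤ j → j ≤ N → 1 ≤ k → k ≤ N → j ≠ k → brak q lam (u j - u k) ≠ 0) :
    partW q lam ω12 M N u v x a = ellG q lam M N u v x (aSc ω12 a) := by
  obtain ⟨hAB, hd, hodd⟩ := brak_facts q hq0 hq1 lam
  have ha : ∀ k : ℤ, brak q lam (aSc ω12 a + k) ≠ 0 := fun k => by
    have := hbrA (a.1 + k, a.2)
    rwa [show aSc ω12 (a.1 + k, a.2) = aSc ω12 a + k by simp [aSc]; ring] at this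
  have hx1' : ∀ j, 1 ≤ j → j ≤ N → 1 ≤ x j := fun j hj hjN => by
    rcases Nat.eq_or_lt_of_le hj with h | h
    · rw [← h]; exact hx1
    · have := hxmono 1 j le_rfl h hjN; omega
  have hxM' : ∀ j, 1 ≤ j → j ≤ N → x j ≤ M := fun j hj hjN => by
    rcases Nat.eq_or_lt_of_le hjN with h | h
    · rw [h]; exact hxN
    · have := hxmono j N hj h le_rfl; omega
  have hXM : ∀ j : Fin N, x ((j : ℕ) + 1) - 1 < M := fun j => by
    have h1 := hx1' (j + 1) (by omega) (by omega)
    have h2 := hxM' (j + 1) (by omega) (by omega)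
    omega
  have hXmono : StrictMono (fun j : Fin N => x ((j : ℕ) + 1) - 1) := fun i j hij => by
    have h1 := hx1' (i + 1) (by omega) (by omega)
    have h2 := hxmono (i + 1) (j + 1) (by omega) (by have : (i : ℕ) < j := hij; omega) (by omega)
    show x ((i : ℕ) + 1) - 1 < x ((j : ℕ) + 1) - 1
    omega
  have hcnt : ∀ k ≤ M, (btmCount N x k : ℤ) =
      DM.cnt (Finset.univ.image (fun j : Fin N => x ((j : ℕ) + 1) - 1)) k := by
    intro k _
    have himg : (Finset.univ.image (fun j : Fin N => x ((j : ℕ) + 1) - 1)).filter (· < k) =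
        ((Finset.Icc 1 N).filter fun j => x j ≤ k).image (fun j => x j - 1) := by
      ext z
      simp only [Finset.mem_filter, Finset.mem_image, Finset.mem_univ, true_and, Finset.mem_Icc]
      constructor
      · rintro ⟨⟨j, rfl⟩, hz⟩
        exact ⟨j + 1, ⟨⟨by omega, by omega⟩, by omega⟩, rfl⟩
      · rintro ⟨j, ⟨⟨hj1, hjN⟩, hjk⟩, rfl⟩
        have := hx1' j hj1 hjN
        exact ⟨⟨⟨j - 1, by omega⟩, by simp only [Nat.sub_add_cancel hj1]⟩, by omega⟩
    rw [DM.cnt, himg, Finset.card_image_of_injOn, btmCount]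
    intro i hi j hj hij
    simp only [Finset.coe_filter, Finset.mem_Icc, Set.mem_setOf_eq] at hi hj
    have h1 := hx1' i hi.1.1 hi.1.2
    have h2 := hx1' j hj.1.1 hj.1.2
    have hij : x i - 1 = x j - 1 := hij
    rcases lt_trichotomy i j with h | h | h
    · have := hxmono i j hi.1.1 h hj.1.2; omega
    · exact h
    · have := hxmono j i hj.1.1 h hi.1.2; omega
  have hSx : Finset.univ.image (fun j : Fin N => x ((j : ℕ) + 1) - 1) ∈ (Finset.range M).powerset := by
    rw [Finset.mem_powerset]
    intro z hz
    obtain ⟨j, -, rfl⟩ := Finset.mem_image.1 hz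
    exact Finset.mem_range.2 (hXM j)
  rw [DM.partW_eq q lam ω12 M N hN u v x a _ hSx hcnt,
    DM.Zf_det' (brak q lam) hd hodd hbr1 hAB (aSc ω12 a) ha _ _ M N
      (fun j hj i hij => hu _ _ (by omega) (by omega) (by omega) (by omega) (by omega)) _ hXmono hXM]
  exact DM.ellG_eq q lam M N u v x (aSc ω12 a) hodd hbr1 ha hu hx1' hxmono hxM'

end
end

section
/- For (M, N) = (3, 2) and x = (1, 3), the following elliptic expansion identity holds: ([1 + u₂ − u₁]/[1]) · E_{3,2}(u₁, u₂|v₁, v₂, v₃|1, 3|a₁₂) = ([1+u₂−v₁]/[1])([1+u₂−v₂]/[1])([a₁₂+2−u₂+v₃]/[a₁₂+2]) · ([a₁₂+1−u₁+v₁]/[a₁₂+1])([u₁−v₂][−a₁₂−3]/([1][−a₁₂−2]))([1−u₁+v₃]/[1]) + ([1+u₂−v₁]/[1])([a₁₂+1−u₂+v₂]/[a₁₂+1])([u₂−v₃][−a₁₂−3]/([1][−a₁₂−2])) · ([a₁₂+1−u₁+v₁]/[a₁₂+1])([−a₁₂−2−u₁+v₂]/[−a₁₂−2])([a₁₂+3−u₁+v₃]/[a₁₂+3])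 + ([a₁₂−u₂+v₁]/[a₁₂])([u₂−v₂][−a₁₂−2]/([1][−a₁₂−1]))([u₂−v₃][−a₁₂−3]/([1][−a₁₂−2])) · ([u₁−v₁][a₁₂]/([1][a₁₂+1]))([1+u₁−v₂]/[1])([a₁₂+3−u₁+v₃]/[a₁₂+3]). -/
open Complex

noncomputable section

lemma aux_summ (q z : ℂ) (hq0 : q ≠ 0) (hq : ‖q‖ < 1) (hz : z ≠ 0) :
    Summable (fun j : ℤ => q ^ (j * j) * z ^ j) := by
  have hpi : (Real.pi : ℂ) ≠ 0 := by exact_mod_cast Real.pi_ne_zero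
  have key := (summable_jacobiTheta₂_term_iff (Complex.log z / (2 * Real.pi * I))
    (Complex.log q / (Real.pi * I))).2 (by
      have : Complex.log q / (Real.pi * I) = ((-1 / Real.pi : ℝ) : ℂ) * (I * Complex.log q) := by
        push_cast
        field_simp
        rw [I_sq]; ring
      rw [this, Complex.im_ofReal_mul]
      simp only [mul_im, I_re, I_im, zero_mul, one_mul, zero_add, Complex.log_re]
      have h1 : Real.log ‖q‖ < 0 := Real.log_neg (norm_pos_iff.2 hq0) hq
      have := Real.pi_pos
      rw [div_mul_eq_mul_div]
      apply div_pos _ this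
      linarith)
  refine key.congr fun j => ?_
  unfold jacobiTheta₂_term
  rw [Complex.exp_add]
  have e1 : 2 * (Real.pi : ℂ) * I * j * (Complex.log z / (2 * Real.pi * I)) = j * Complex.log z := by
    field_simp
  have e2 : (Real.pi : ℂ) * I * j ^ 2 * (Complex.log q / (Real.pi * I))
      = ((j * j : ℤ) : ℂ) * Complex.log q := by
    push_cast
    field_simp
  rw [e1, e2, Complex.exp_int_mul, Complex.exp_int_mul, Complex.exp_log hz, Complex.exp_log hq0,
    mul_comm]

def rr (q : ℂ) (n : ℤ) : ℂ :=
  if n < 0 then 0 else (∏ k ∈ Finset.range n.toNat, (1 - q ^ (2 * k + 2)))⁻¹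

lemma one_sub_pow_ne (q : ℂ) (hq : ‖q‖ < 1) (k : ℕ) : 1 - q ^ (2 * k + 2) ≠ 0 := by
  intro h
  have h1 : q ^ (2 * k + 2) = 1 := by linear_combination -h
  have h2 : ‖q‖ ^ (2 * k + 2) = 1 := by rw [← norm_pow, h1]; simp
  have h3 : ‖q‖ ^ (2 * k + 2) < 1 := pow_lt_one₀ (norm_nonneg _) hq (by omega)
  linarith

lemma rr_rec (q : ℂ) (hq : ‖q‖ < 1) (n : ℤ) :
    rr q (n - 1) = (1 - q ^ (2 * n)) * rr q n := by
  rcases lt_trichotomy n 0 with h | h | h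
  · simp [rr, h, show n - 1 < 0 by omega]
  · subst h; simp [rr]
  · obtain ⟨m, rfl⟩ : ∃ m : ℕ, n = m + 1 := ⟨(n - 1).toNat, by omega⟩
    have e : (2 * ((m : ℤ) + 1)) = ((2 * m + 2 : ℕ) : ℤ) := by push_cast; ring
    have e2 : ((m : ℤ) + 1).toNat = m + 1 := by omega
    rw [e, zpow_natCast]
    unfold rr
    rw [if_neg (by omega), if_neg (by omega), e2, Finset.prod_range_succ, mul_inv]
    simp only [add_sub_cancel_right, Int.toNat_natCast]
    have := one_sub_pow_ne q hq m
    field_simp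

lemma hasSum_cg {ι : Type*} {f g : ι → ℂ} {a b : ℂ} (h : HasSum f a) (hf : ∀ j, g j = f j)
    (hab : b = a) : HasSum g b := by
  subst hab
  rwa [funext hf]

lemma finite_jtp (q z : ℂ) (hq0 : q ≠ 0) (hq : ‖q‖ < 1) (hz : z ≠ 0) (n : ℕ) :
    HasSum (fun j : ℤ => (-1) ^ j * q ^ (j * j - j) * (rr q (n - j) * rr q (n + j)) * z ^ j)
      ((∏ k ∈ Finset.range n, ((1 - z * q ^ (2 * k)) * (1 - z⁻¹ * q ^ (2 * k + 2)))) *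
        rr q (2 * n)) := by
  induction n with
  | zero =>
    have := hasSum_single (f := fun j : ℤ =>
      (-1) ^ j * q ^ (j * j - j) * (rr q ((0 : ℕ) - j) * rr q ((0 : ℕ) + j)) * z ^ j) 0 (by
        intro j hj
        rcases lt_or_gt_of_ne hj with h | h
        · simp [rr, h]
        · simp [rr, h])
    simpa [rr] using this
  | succ n ih =>
    set F := (∏ k ∈ Finset.range n, ((1 - z * q ^ (2 * k)) * (1 - z⁻¹ * q ^ (2 * k + 2)))) with hF
    have s1 := (Equiv.subRight (1 : ℤ)).hasSum_iff.2 ih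
    have s2 := (Equiv.addRight (1 : ℤ)).hasSum_iff.2 ih
    have tot := ((ih.mul_left (1 + q ^ (4 * n + 2))).sub ((s1.mul_left (z * q ^ (2 * n))))).sub
      (s2.mul_left (z⁻¹ * q ^ (2 * n + 2)))
    have a1 := rr_rec q hq (2 * n + 1)
    have a2 := rr_rec q hq (2 * n + 2)
    rw [show (2 * (n : ℤ) + 1 - 1) = 2 * n by ring] at a1
    rw [show (2 * (n : ℤ) + 2 - 1) = 2 * n + 1 by ring] at a2
    have d1 : (1 - q ^ (2 * (2 * (n : ℤ) + 1))) ≠ 0 := by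
      have := one_sub_pow_ne q hq (2 * n)
      rw [← zpow_natCast] at this
      push_cast at this
      rwa [show (2 * (2 * (n : ℤ) + 1)) = 2 * (2 * n) + 2 by ring]
    have d2 : (1 - q ^ (2 * (2 * (n : ℤ) + 2))) ≠ 0 := by
      have := one_sub_pow_ne q hq (2 * n + 1)
      rw [← zpow_natCast] at this
      push_cast at this
      rwa [show (2 * (2 * (n : ℤ) + 2)) = 2 * (2 * n + 1) + 2 by ring]
    have d := mul_ne_zero d1 d2
    have tot2 := tot.mul_left ((1 - q ^ (2 * (2 * (n : ℤ) + 1))) * (1 - q ^ (2 * (2 * (n : ℤ) + 2))))⁻¹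
    refine hasSum_cg tot2 (fun j => ?_) ?_
    · simp only [Function.comp, Equiv.subRight_apply, Equiv.coe_addRight]
      rw [eq_inv_mul_iff_mul_eq₀ d]
      have b1 := rr_rec q hq (n + 1 - j)
      have b2 := rr_rec q hq (n - j)
      have c1 := rr_rec q hq (n + 1 + j)
      have c2 := rr_rec q hq (n + j)
      rw [show ((n : ℤ) + 1 - j - 1) = n - j by ring] at b1
      rw [show ((n : ℤ) + 1 + j - 1) = n + j by ring] at c1
      rw [show ((n : ℤ) - (j - 1)) = n + 1 - j by ring,
        show ((n : ℤ) + (j - 1)) = n + j - 1 by ring,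
        show ((n : ℤ) - (j + 1)) = n - j - 1 by ring,
        show ((n : ℤ) + (j + 1)) = n + 1 + j by ring]
      rw [b2, c2, b1, c1]
      push_cast
      generalize rr q (n + 1 - j) = R1
      generalize rr q (n + 1 + j) = R2
      have hm : (-1 : ℂ) ≠ 0 := by norm_num
      rw [show ((j - 1) * (j - 1) - (j - 1)) = (j * j - j) - 2 * j + 2 by ring,
        show ((j + 1) * (j + 1) - (j + 1)) = (j * j - j) + 2 * j by ring]
      generalize j * j - j = J
      rw [← zpow_natCast q (4 * n + 2), ← zpow_natCast q (2 * n), ← zpow_natCast q (2 * n + 2)]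
      push_cast
      have x1 : q ^ (2 * (2 * (n : ℤ) + 1)) = (q ^ (n : ℤ)) ^ 4 * q ^ 2 := by
        simp only [← zpow_natCast, ← zpow_mul, ← zpow_add₀ hq0]; congr 1; push_cast; ring
      have x2 : q ^ (2 * (2 * (n : ℤ) + 2)) = (q ^ (n : ℤ)) ^ 4 * q ^ 4 := by
        simp only [← zpow_natCast, ← zpow_mul, ← zpow_add₀ hq0]; congr 1; push_cast; ring
      have x3 : q ^ (4 * (n : ℤ) + 2) = (q ^ (n : ℤ)) ^ 4 * q ^ 2 := by
        simp only [← zpow_natCast, ← zpow_mul, ← zpow_add₀ hq0]; congr 1; push_cast; ring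
      have x4 : q ^ (2 * (n : ℤ) + 2) = (q ^ (n : ℤ)) ^ 2 * q ^ 2 := by
        simp only [← zpow_natCast, ← zpow_mul, ← zpow_add₀ hq0]; congr 1; push_cast; ring
      have x5 : q ^ (2 * (n : ℤ)) = (q ^ (n : ℤ)) ^ 2 := by
        simp only [← zpow_natCast, ← zpow_mul, ← zpow_add₀ hq0]; congr 1; push_cast; ring
      have x6 : q ^ (2 * ((n : ℤ) + 1 - j)) = (q ^ (n : ℤ)) ^ 2 * q ^ 2 / (q ^ j) ^ 2 := by
        simp only [← zpow_natCast, ← zpow_mul, ← zpow_add₀ hq0, ← zpow_sub₀ hq0]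
        congr 1; push_cast; ring
      have x7 : q ^ (2 * ((n : ℤ) + 1 + j)) = (q ^ (n : ℤ)) ^ 2 * q ^ 2 * (q ^ j) ^ 2 := by
        simp only [← zpow_natCast, ← zpow_mul, ← zpow_add₀ hq0]
        congr 1; push_cast; ring
      have x8 : q ^ (2 * ((n : ℤ) - j)) = (q ^ (n : ℤ)) ^ 2 / (q ^ j) ^ 2 := by
        simp only [← zpow_natCast, ← zpow_mul, ← zpow_add₀ hq0, ← zpow_sub₀ hq0]
        congr 1; push_cast; ring
      have x9 : q ^ (2 * ((n : ℤ) + j)) = (q ^ (n : ℤ)) ^ 2 * (q ^ j) ^ 2 := by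
        simp only [← zpow_natCast, ← zpow_mul, ← zpow_add₀ hq0]
        congr 1; push_cast; ring
      have x10 : q ^ (J - 2 * j + 2) = q ^ J * q ^ 2 / (q ^ j) ^ 2 := by
        simp only [← zpow_natCast, ← zpow_mul, ← zpow_add₀ hq0, ← zpow_sub₀ hq0]
        congr 1; push_cast; ring
      have x11 : q ^ (J + 2 * j) = q ^ J * (q ^ j) ^ 2 := by
        simp only [← zpow_natCast, ← zpow_mul, ← zpow_add₀ hq0]
        congr 1; push_cast; ring
      rw [x1, x2, x3, x4, x5, x6, x7, x8, x9, x10, x11, zpow_add₀ hm, zpow_sub₀ hm, zpow_add₀ hz,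
        zpow_sub₀ hz, zpow_one, zpow_one]
      have hX : q ^ j ≠ 0 := zpow_ne_zero _ hq0
      generalize q ^ j = X at *
      generalize q ^ (n : ℤ) = Q at *
      field_simp
      ring
    · rw [Finset.prod_range_succ, ← hF]
      push_cast
      rw [show (2 * ((n : ℤ) + 1)) = 2 * n + 2 by ring, eq_inv_mul_iff_mul_eq₀ d, a1, a2]
      field_simp
      ring

open Filter Topology in
lemma rr_tendsto (q : ℂ) (hq : ‖q‖ < 1) :
    ∃ R : ℂ, R ≠ 0 ∧ Tendsto (fun n : ℕ => rr q n) atTop (𝓝 R) := by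
  have hs : Summable (fun k : ℕ => ‖-q ^ (2 * k + 2)‖) := by
    have h2 : ‖q‖ ^ 2 < 1 := pow_lt_one₀ (norm_nonneg _) hq (by norm_num)
    refine ((summable_geometric_of_lt_one (by positivity) h2).mul_left (‖q‖ ^ 2)).congr ?_
    intro k
    rw [norm_neg, norm_pow]; ring
  have hm := multipliable_one_add_of_summable hs
  have hne : ∏' k : ℕ, (1 + -q ^ (2 * k + 2)) ≠ 0 :=
    tprod_one_add_ne_zero_of_summable (fun k => by
      simpa [sub_eq_add_neg] using one_sub_pow_ne q hq k) hs
  refine ⟨(∏' k : ℕ, (1 + -q ^ (2 * k + 2)))⁻¹, inv_ne_zero hne, ?_⟩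
  refine (hm.tendsto_prod_tprod_nat.inv₀ hne).congr fun n => ?_
  simp [rr, sub_eq_add_neg]

lemma fac_multipliable (q c : ℂ) (hq : ‖q‖ < 1) :
    Multipliable (fun n : ℕ => (1 - 2 * q ^ (2 * n + 2) * c + q ^ (4 * n + 4)) *
      (1 - q ^ (2 * n + 2))) := by
  have h2 : ‖q‖ ^ 2 < 1 := pow_lt_one₀ (norm_nonneg _) hq (by norm_num)
  have h4 : ‖q‖ ^ 4 < 1 := pow_lt_one₀ (norm_nonneg _) hq (by norm_num)
  have g2 : Summable (fun n : ℕ => ‖-(2 * q ^ (2 * n + 2) * c)‖) := by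
    refine ((summable_geometric_of_lt_one (by positivity) h2).mul_left (2 * ‖q‖ ^ 2 * ‖c‖)).congr ?_
    intro k
    rw [norm_neg, norm_mul, norm_mul, norm_pow, Complex.norm_two]; ring
  have g3 : Summable (fun n : ℕ => ‖-(q ^ (2 * n + 2))‖) := by
    refine ((summable_geometric_of_lt_one (by positivity) h2).mul_left (‖q‖ ^ 2)).congr ?_
    intro k
    rw [norm_neg, norm_pow]; ring
  have g4 : Summable (fun n : ℕ => ‖q ^ (4 * n + 4)‖) := by
    refine ((summable_geometric_of_lt_one (by positivity) h4).mul_left (‖q‖ ^ 4)).congr ?_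
    intro k
    rw [norm_pow]; ring
  have m1 : Multipliable (fun n : ℕ => 1 + (-(2 * q ^ (2 * n + 2) * c) + q ^ (4 * n + 4))) :=
    multipliable_one_add_of_summable
      (Summable.of_nonneg_of_le (fun _ => norm_nonneg _) (fun _ => norm_add_le _ _) (g2.add g4))
  have m2 : Multipliable (fun n : ℕ => 1 + -(q ^ (2 * n + 2))) :=
    multipliable_one_add_of_summable g3
  refine (m1.mul m2).congr fun n => ?_
  ring

open Filter Topology in
lemma jtp (q w : ℂ) (hq0 : q ≠ 0) (hq : ‖q‖ < 1) (hw : w ≠ 0) :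
    HasSum (fun j : ℤ => (-1) ^ j * q ^ (j * j - j) * w ^ (2 * j - 1))
    ((w⁻¹ - w) * ∏' n : ℕ, (1 - 2 * q ^ (2 * n + 2) * ((w ^ 2 + (w ^ 2)⁻¹) / 2) + q ^ (4 * n + 4)) *
      (1 - q ^ (2 * n + 2))) := by
  obtain ⟨R, hR, hRt⟩ := rr_tendsto q hq
  have hz : w ^ 2 ≠ 0 := pow_ne_zero _ hw
  set z := w ^ 2 with hzdef
  set G := ∏' n : ℕ, (1 - 2 * q ^ (2 * n + 2) * ((z + z⁻¹) / 2) + q ^ (4 * n + 4)) *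
      (1 - q ^ (2 * n + 2)) with hG
  have hGt := (fac_multipliable q ((z + z⁻¹) / 2) hq).tendsto_prod_tprod_nat
  rw [← hG] at hGt
  -- summability of the series
  have hS : Summable (fun j : ℤ => (-1) ^ j * q ^ (j * j - j) * z ^ j) := by
    refine (aux_summ q (-z / q) hq0 hq (div_ne_zero (neg_ne_zero.2 hz) hq0)).congr fun j => ?_
    rw [zpow_sub₀ hq0, div_zpow, neg_eq_neg_one_mul, mul_zpow]
    field_simp
  -- boundedness
  obtain ⟨B, hB⟩ : ∃ B : ℝ, ∀ n : ℤ, ‖rr q n‖ ≤ B := by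
    obtain ⟨B, hB⟩ := (Metric.isBounded_range_of_tendsto _ hRt).exists_norm_le
    refine ⟨B, fun n => ?_⟩
    have hB0 : 0 ≤ B := (norm_nonneg _).trans (hB (rr q (0 : ℕ)) ⟨0, rfl⟩)
    by_cases h : n < 0
    · simp [rr, h, hB0]
    · lift n to ℕ using (by omega)
      exact hB _ ⟨n, rfl⟩
  have hRz : Tendsto (fun n : ℤ => rr q n) atTop (𝓝 R) := by
    have : Tendsto (fun n : ℤ => rr q (n.toNat : ℕ)) atTop (𝓝 R) :=
      hRt.comp (tendsto_atTop_atTop.2 fun b => ⟨b, fun a ha => by omega⟩)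
    refine this.congr' ?_
    filter_upwards [eventually_ge_atTop 0] with n hn
    rw [Int.toNat_of_nonneg hn]
  have lim1 : Tendsto (fun n : ℕ => ∑' j : ℤ,
      (-1) ^ j * q ^ (j * j - j) * (rr q (n - j) * rr q (n + j)) * z ^ j) atTop
      (𝓝 (∑' j : ℤ, (-1) ^ j * q ^ (j * j - j) * (R * R) * z ^ j)) := by
    refine tendsto_tsum_of_dominated_convergence
      (bound := fun j : ℤ => ‖(-1) ^ j * q ^ (j * j - j) * z ^ j‖ * (B * B))
      (hS.norm.mul_right _) (fun j => ?_) (Eventually.of_forall fun n j => ?_)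
    · refine Tendsto.mul_const _ (Tendsto.const_mul _ (Tendsto.mul ?_ ?_))
      · exact hRz.comp ((tendsto_atTop_add_const_right _ (-j) tendsto_natCast_atTop_atTop))
      · exact hRz.comp ((tendsto_atTop_add_const_right _ j tendsto_natCast_atTop_atTop))
    · have e : (-1) ^ j * q ^ (j * j - j) * (rr q (n - j) * rr q (n + j)) * z ^ j =
        ((-1) ^ j * q ^ (j * j - j) * z ^ j) * (rr q (n - j) * rr q (n + j)) := by ring
      rw [e, norm_mul _ (rr q (n - j) * rr q (n + j)), norm_mul (rr q (n - j))]
      have hB0 : 0 ≤ B := (norm_nonneg _).trans (hB 0)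
      gcongr
      · exact hB _
      · exact hB _
  have lim2 := lim1.congr fun n => (finite_jtp q z hq0 hq hz n).tsum_eq
  have hq2 : Tendsto (fun n : ℕ => q ^ (2 * n)) atTop (𝓝 0) := by
    simp only [pow_mul]
    refine tendsto_pow_atTop_nhds_zero_of_norm_lt_one ?_
    rw [norm_pow]
    exact pow_lt_one₀ (norm_nonneg _) hq (by norm_num)
  have lim3 := lim2.mul ((hq2.const_mul z).const_sub 1)
  have hR2 : Tendsto (fun n : ℕ => rr q (2 * n)) atTop (𝓝 R) := by
    refine hRz.comp ?_
    refine tendsto_atTop_mono (fun n => ?_) (tendsto_natCast_atTop_atTop (R := ℤ))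
    omega
  have lim4 := ((hGt.const_mul (1 - z)).mul hRt).mul hR2
  have fin : ∀ n : ℕ, (∏ k ∈ Finset.range n, ((1 - z * q ^ (2 * k)) * (1 - z⁻¹ * q ^ (2 * k + 2)))) *
      (1 - z * q ^ (2 * n)) = (1 - z) * (∏ k ∈ Finset.range n,
        ((1 - 2 * q ^ (2 * k + 2) * ((z + z⁻¹) / 2) + q ^ (4 * k + 4)) *
      (1 - q ^ (2 * k + 2)))) * rr q n := by
    intro n
    induction n with
    | zero => simp [rr]
    | succ n ih =>
      rw [Finset.prod_range_succ, Finset.prod_range_succ]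
      have a1 := rr_rec q hq (n + 1)
      rw [show ((n : ℤ) + 1 - 1) = n by ring, show (2 * ((n : ℤ) + 1)) = ((2 * n + 2 : ℕ) : ℤ) by
        push_cast; ring, zpow_natCast] at a1
      push_cast
      rw [a1] at ih
      have e : (1 - 2 * q ^ (2 * n + 2) * ((z + z⁻¹) / 2) + q ^ (4 * n + 4)) =
          (1 - z⁻¹ * q ^ (2 * n + 2)) * (1 - z * q ^ (2 * (n + 1))) := by
        field_simp
        ring
      rw [e]
      linear_combination (1 - z⁻¹ * q ^ (2 * n + 2)) * (1 - z * q ^ (2 * (n + 1))) * ih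
  have lim5 := lim4.congr (fun n => by rw [← fin n])
  have lim6 := lim3.congr (f₂ := fun n : ℕ => (∏ k ∈ Finset.range n, ((1 - z * q ^ (2 * k)) * (1 - z⁻¹ * q ^ (2 * k + 2)))) *
      (1 - z * q ^ (2 * n)) * rr q (2 * n)) (fun n => by ring)
  have eq := tendsto_nhds_unique lim5 lim6
  have e2 : ∑' j : ℤ, (-1) ^ j * q ^ (j * j - j) * (R * R) * z ^ j =
      (∑' j : ℤ, (-1) ^ j * q ^ (j * j - j) * z ^ j) * (R * R) := by
    rw [← tsum_mul_right]
    exact tsum_congr fun j => by ring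
  rw [e2] at eq
  have e3 : (1 - z) * G = ∑' j : ℤ, (-1) ^ j * q ^ (j * j - j) * z ^ j := by
    apply mul_right_cancel₀ (mul_ne_zero hR hR)
    linear_combination eq
  refine hasSum_cg (hS.hasSum.mul_left w⁻¹) (fun j => ?_) ?_
  · rw [zpow_sub₀ hw, zpow_mul, hzdef]
    simp only [zpow_one, zpow_ofNat]
    field_simp
  · rw [← e3, hzdef]
    field_simp

def TT (q w : ℂ) : ℂ := ∑' j : ℤ, (-1) ^ j * q ^ (j * j - j) * w ^ (2 * j - 1)
def AA (q w : ℂ) : ℂ := ∑' a : ℤ, q ^ (2 * (a * a)) * w ^ (4 * a)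
def BB (q w : ℂ) : ℂ := ∑' b : ℤ, q ^ (2 * (b * b) + 2 * b) * w ^ (4 * b + 2)

lemma AA_summ (q w : ℂ) (hq0 : q ≠ 0) (hq : ‖q‖ < 1) (hw : w ≠ 0) :
    Summable (fun a : ℤ => q ^ (2 * (a * a)) * w ^ (4 * a)) := by
  refine (aux_summ (q ^ 2) (w ^ 4) (pow_ne_zero _ hq0) ?_ (pow_ne_zero _ hw)).congr fun j => ?_
  · rw [norm_pow]
    exact pow_lt_one₀ (norm_nonneg _) hq (by norm_num)
  · rw [zpow_mul q, zpow_mul w]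
    simp only [zpow_ofNat]

lemma BB_summ (q w : ℂ) (hq0 : q ≠ 0) (hq : ‖q‖ < 1) (hw : w ≠ 0) :
    Summable (fun b : ℤ => q ^ (2 * (b * b) + 2 * b) * w ^ (4 * b + 2)) := by
  refine ((aux_summ (q ^ 2) (q ^ 2 * w ^ 4) (pow_ne_zero _ hq0) ?_ (mul_ne_zero (pow_ne_zero _ hq0)
    (pow_ne_zero _ hw))).mul_right (w ^ 2)).congr fun j => ?_
  · rw [norm_pow]
    exact pow_lt_one₀ (norm_nonneg _) hq (by norm_num)
  · rw [zpow_add₀ hq0, zpow_add₀ hw, zpow_mul q, zpow_mul w, zpow_mul q, mul_zpow]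
    simp only [zpow_ofNat]
    ring

lemma hasSum_mul_cg {f g : ℤ → ℂ} (hf : Summable f) (hg : Summable g) :
    HasSum (fun p : ℤ × ℤ => f p.1 * g p.2) ((∑' j, f j) * ∑' j, g j) := by
  have h := summable_mul_of_summable_norm hf.norm hg.norm
  rw [tsum_mul_tsum_of_summable_norm hf.norm hg.norm]
  exact h.hasSum

lemma TT_mul (q x y : ℂ) (hq0 : q ≠ 0) (hq : ‖q‖ < 1) (hx : x ≠ 0) (hy : y ≠ 0) :
    TT q (x * y) * TT q (x / y) = BB q x * AA q y - AA q x * BB q y := by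
  have hxy := mul_ne_zero hx hy
  have hxy' := div_ne_zero hx hy
  have hT := hasSum_mul_cg (jtp q (x * y) hq0 hq hxy).summable (jtp q (x / y) hq0 hq hxy').summable
  have h1 := hasSum_mul_cg (AA_summ q x hq0 hq hx) (BB_summ q y hq0 hq hy)
  have h2 := hasSum_mul_cg (AA_summ q y hq0 hq hy) (BB_summ q x hq0 hq hx)
  set F : ℤ × ℤ → ℂ := (fun p : ℤ × ℤ => (-1) ^ p.1 * q ^ (p.1 * p.1 - p.1) * (x * y) ^ (2 * p.1 - 1) *
    ((-1) ^ p.2 * q ^ (p.2 * p.2 - p.2) * (x / y) ^ (2 * p.2 - 1))) with hF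
  let e0 : ℤ × ℤ → ℤ × ℤ := fun p => (p.1 + p.2 + 1, p.1 - p.2)
  let e1 : ℤ × ℤ → ℤ × ℤ := fun p => (p.1 + p.2 + 1, p.2 + 1 - p.1)
  have i0 : Function.Injective e0 := by
    rintro ⟨a, b⟩ ⟨c, d⟩ h
    simp only [e0, Prod.mk.injEq] at h ⊢
    omega
  have i1 : Function.Injective e1 := by
    rintro ⟨a, b⟩ ⟨c, d⟩ h
    simp only [e1, Prod.mk.injEq] at h ⊢
    omega
  have hc : IsCompl (Set.range e0) (Set.range e1) := by
    constructor
    · rw [Set.disjoint_left]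
      rintro p ⟨⟨a, b⟩, rfl⟩ ⟨⟨c, d⟩, h⟩
      simp only [e0, e1, Prod.mk.injEq] at h
      omega
    · rw [codisjoint_iff]
      refine Set.eq_univ_iff_forall.2 ?_
      rintro ⟨j, k⟩
      rcases Int.even_or_odd' (j + k) with ⟨c, h | h⟩
      · right
        refine ⟨(j - c, c - 1), ?_⟩
        simp only [e1, Prod.mk.injEq]
        omega
      · left
        refine ⟨(c, j - c - 1), ?_⟩
        simp only [e0, Prod.mk.injEq]
        omega
  have hm : ∀ n : ℤ, (-1 : ℂ) ^ (2 * n) = 1 := fun n => by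
    rw [zpow_mul]; norm_num
  have hm1 : (-1 : ℂ) ≠ 0 := by norm_num
  have k0 : HasSum (F ∘ e0) (-(AA q x * BB q y)) := by
    refine hasSum_cg h1.neg (fun p => ?_) rfl
    obtain ⟨a, b⟩ := p
    simp only [hF, e0, Function.comp]
    have s : (-1 : ℂ) ^ (a + b + 1) * (-1) ^ (a - b) = -1 := by
      rw [← zpow_add₀ hm1, show a + b + 1 + (a - b) = 2 * a + 1 by ring, zpow_add₀ hm1, hm]; simp
    have t : q ^ ((a + b + 1) * (a + b + 1) - (a + b + 1)) * q ^ ((a - b) * (a - b) - (a - b)) =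
        q ^ (2 * (a * a)) * q ^ (2 * (b * b) + 2 * b) := by
      rw [← zpow_add₀ hq0, ← zpow_add₀ hq0]; congr 1; ring
    have r1 : x ^ (2 * (a + b + 1) - 1) * x ^ (2 * (a - b) - 1) = x ^ (4 * a) := by
      rw [← zpow_add₀ hx]; congr 1; ring
    have r2 : y ^ (2 * (a + b + 1) - 1) / y ^ (2 * (a - b) - 1) = y ^ (4 * b + 2) := by
      rw [← zpow_sub₀ hy]; congr 1; ring
    rw [mul_zpow, div_zpow, ← r1, ← r2]
    linear_combination (q ^ ((a + b + 1) * (a + b + 1) - (a + b + 1)) * q ^ ((a - b) * (a - b) - (a - b))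
      * (x ^ (2 * (a + b + 1) - 1) * x ^ (2 * (a - b) - 1)) *
        (y ^ (2 * (a + b + 1) - 1) / y ^ (2 * (a - b) - 1))) * s -
      ((x ^ (2 * (a + b + 1) - 1) * x ^ (2 * (a - b) - 1)) *
        (y ^ (2 * (a + b + 1) - 1) / y ^ (2 * (a - b) - 1))) * t
  have k1 : HasSum (F ∘ e1) (AA q y * BB q x) := by
    refine hasSum_cg h2 (fun p => ?_) rfl
    obtain ⟨a, b⟩ := p
    simp only [hF, e1, Function.comp]
    have s : (-1 : ℂ) ^ (a + b + 1) * (-1) ^ (b + 1 - a) = 1 := by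
      rw [← zpow_add₀ hm1, show a + b + 1 + (b + 1 - a) = 2 * (b + 1) by ring, hm]
    have t : q ^ ((a + b + 1) * (a + b + 1) - (a + b + 1)) *
        q ^ ((b + 1 - a) * (b + 1 - a) - (b + 1 - a)) =
        q ^ (2 * (a * a)) * q ^ (2 * (b * b) + 2 * b) := by
      rw [← zpow_add₀ hq0, ← zpow_add₀ hq0]; congr 1; ring
    have r1 : x ^ (2 * (a + b + 1) - 1) * x ^ (2 * (b + 1 - a) - 1) = x ^ (4 * b + 2) := by
      rw [← zpow_add₀ hx]; congr 1; ring
    have r2 : y ^ (2 * (a + b + 1) - 1) / y ^ (2 * (b + 1 - a) - 1) = y ^ (4 * a) := by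
      rw [← zpow_sub₀ hy]; congr 1; ring
    rw [mul_zpow, div_zpow, ← r1, ← r2]
    linear_combination (q ^ ((a + b + 1) * (a + b + 1) - (a + b + 1)) *
        q ^ ((b + 1 - a) * (b + 1 - a) - (b + 1 - a))
      * (x ^ (2 * (a + b + 1) - 1) * x ^ (2 * (b + 1 - a) - 1)) *
        (y ^ (2 * (a + b + 1) - 1) / y ^ (2 * (b + 1 - a) - 1))) * s +
      ((x ^ (2 * (a + b + 1) - 1) * x ^ (2 * (b + 1 - a) - 1)) *
        (y ^ (2 * (a + b + 1) - 1) / y ^ (2 * (b + 1 - a) - 1))) * t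
  have k := HasSum.add_isCompl (f := F) hc (i0.hasSum_range_iff.2 k0) (i1.hasSum_range_iff.2 k1)
  have := hT.unique k
  unfold TT
  rw [this]
  ring

lemma theta_eq_s19 (q : ℝ) (hq0 : 0 < q) (hq1 : q < 1) (u : ℂ) :
    theta q u = (q : ℂ) ^ (1 / 4 : ℂ) * I *
      TT q (Complex.exp (Real.pi * u / (2 * (Kone q : ℂ)) * I)) := by
  have hq : (q : ℂ) ≠ 0 := by exact_mod_cast hq0.ne'
  have hn : ‖(q : ℂ)‖ < 1 := by rw [Complex.norm_real, Real.norm_of_nonneg hq0.le]; exact hq1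
  have h := (jtp q (Complex.exp (Real.pi * u / (2 * (Kone q : ℂ)) * I)) hq hn (Complex.exp_ne_zero _)).tsum_eq
  unfold TT theta
  rw [h]
  have hs : Real.pi * u / (Kone q : ℂ) = 2 * (Real.pi * u / (2 * (Kone q : ℂ))) := by
    by_cases hK : (Kone q : ℂ) = 0
    · simp [hK]
    · field_simp
  rw [hs]
  generalize Real.pi * u / (2 * (Kone q : ℂ)) = s
  have hcos : Complex.cos (2 * s) = (Complex.exp (s * I) ^ 2 + (Complex.exp (s * I) ^ 2)⁻¹) / 2 := by
    rw [Complex.cos, ← Complex.exp_nat_mul, ← Complex.exp_neg]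
    congr 3
    · push_cast; ring_nf
    · push_cast; ring_nf
  rw [hcos, Complex.sin, neg_mul, Complex.exp_neg]
  ring

lemma three_term (q : ℝ) (hq0 : 0 < q) (hq1 : q < 1) (lam x y z w : ℂ) :
    brak q lam (x + y) * brak q lam (x - y) * (brak q lam (z + w) * brak q lam (z - w)) -
    brak q lam (x + z) * brak q lam (x - z) * (brak q lam (y + w) * brak q lam (y - w)) +
    brak q lam (x + w) * brak q lam (x - w) * (brak q lam (y + z) * brak q lam (y - z)) = 0 := by
  have hq : (q : ℂ) ≠ 0 := by exact_mod_cast hq0.ne'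
  have hn : ‖(q : ℂ)‖ < 1 := by rw [Complex.norm_real, Real.norm_of_nonneg hq0.le]; exact hq1
  let e : ℂ → ℂ := fun x => Complex.exp (Real.pi * (lam * x) / (2 * (Kone q : ℂ)) * I)
  have key : ∀ x y : ℂ, brak q lam (x + y) * brak q lam (x - y) = ((q : ℂ) ^ (1 / 4 : ℂ) * I) ^ 2 *
      (BB q (e x) * AA q (e y) - AA q (e x) * BB q (e y)) := by
    intro x y
    rw [← TT_mul q (e x) (e y) hq hn (Complex.exp_ne_zero _) (Complex.exp_ne_zero _)]
    unfold brak
    rw [theta_eq_s19 q hq0 hq1, theta_eq_s19 q hq0 hq1]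
    simp only [e]
    rw [← Complex.exp_add, ← Complex.exp_sub, ← add_mul, ← sub_mul, ← add_div, ← sub_div,
      ← mul_add, ← mul_sub, ← mul_add, ← mul_sub]
    ring
  rw [key, key, key, key, key, key]
  ring

lemma brak_neg (q : ℝ) (lam x : ℂ) : brak q lam (-x) = - brak q lam x := by
  simp [brak, theta, neg_div]

lemma main_alg (o A0 A1 A2 A3 P m b1 b2 b3 b4 b5 b6 b7 c1 c2 c3 c4 c5 c6 c7 d1 d2 d3 d4 d5 d6 : ℂ)
    (ho : o ≠ 0) (h0 : A0 ≠ 0) (h1 : A1 ≠ 0) (h2 : A2 ≠ 0) (h3 : A3 ≠ 0) (hm : m ≠ 0)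
    (E1 : P * b1 * b2 * A2 - b3 * A3 * b4 * m = o * b5 * b6 * b7)
    (E2 : c1 * c2 * b7 * A1 - c3 * c4 * o * m = c5 * c6 * A2 * c7)
    (E3 : d1 * d2 * o * c7 - P * d3 * d4 * A1 - d5 * d6 * A2 * m = 0) :
    P / o * (A3 / A2 * (
      o / m * (c2 / o * (b1 / o)) * (d2 / A1 * (b2 / A3)) * (d1 / o * (c1 / o)) +
      o / -m * (c5 / o * (b5 / o)) * (d3 / A1 * (b6 / A3)) * (d4 / o * (c6 / o)))) =
    d1 / o * (c1 / o) * (b3 / A2) * (d2 / A1) * (c2 * -A3 / (o * -A2)) * (b4 / o) +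
    d1 / o * (c3 / A1) * (b5 * -A3 / (o * -A2)) * (d2 / A1) * (-c4 / -A2) * (b6 / A3) +
    d5 / A0 * (c5 * -A2 / (o * -A1)) * (b5 * -A3 / (o * -A2)) * (d6 * A0 / (o * A1)) *
      (c6 / o) * (b6 / A3) := by
  have key : P * A1 * A2 * (c2 * b1 * d2 * b2 * d1 * c1 - c5 * b5 * d3 * b6 * d4 * c6) =
      m * (d1 * c1 * b3 * d2 * c2 * A3 * b4 * A1 + d1 * c3 * b5 * d2 * c4 * b6 * o ^ 2 +
        d5 * c5 * b5 * d6 * c6 * b6 * A2 ^ 2) := by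
    linear_combination c1 * c2 * d1 * d2 * A1 * E1 + o * b5 * b6 * d1 * d2 * E2 +
      b5 * b6 * c5 * c6 * A2 * E3
  have l : P / o * (A3 / A2 * (
      o / m * (c2 / o * (b1 / o)) * (d2 / A1 * (b2 / A3)) * (d1 / o * (c1 / o)) +
      o / -m * (c5 / o * (b5 / o)) * (d3 / A1 * (b6 / A3)) * (d4 / o * (c6 / o)))) =
      P * A1 * A2 * (c2 * b1 * d2 * b2 * d1 * c1 - c5 * b5 * d3 * b6 * d4 * c6) /
      (o ^ 4 * m * A1 ^ 2 * A2 ^ 2) := by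
    rw [div_neg]
    field_simp
    ring
  rw [l, key, mul_div_assoc]
  simp only [mul_neg, neg_div_neg_eq]
  field_simp

lemma univ_perm_two : (Finset.univ : Finset (Equiv.Perm (Fin 2))) = {1, Equiv.swap 0 1} := by
  decide

/-- for `(M,N) = (3,2)` and `x = (1,3)`, the elliptic expansion identity
`([1+u₂-u₁]/[1]) · E_{3,2}(u₁,u₂|v₁,v₂,v₃|1,3|a₁₂) = (sum of the three explicit
products of elliptic weights)` holds. -/
theorem statement19 (q : ℝ) (hq0 : 0 < q) (hq1 : q < 1) (lam : ℂ) (hlam : lam ≠ 0)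
    (u v : ℕ → ℂ) (x : ℕ → ℕ) (hx1 : x 1 = 1) (hx2 : x 2 = 3) (a12 : ℂ)
    (hbr1 : brak q lam 1 ≠ 0)
    (hu12 : brak q lam (u 1 - u 2) ≠ 0)
    (hu21 : brak q lam (u 2 - u 1) ≠ 0)
    (h0 : brak q lam a12 ≠ 0)
    (h1 : brak q lam (a12 + 1) ≠ 0)
    (h2 : brak q lam (a12 + 2) ≠ 0)
    (h3 : brak q lam (a12 + 3) ≠ 0)
    (h1' : brak q lam (-a12 - 1) ≠ 0)
    (h2' : brak q lam (-a12 - 2) ≠ 0)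
    (h3' : brak q lam (-a12 - 3) ≠ 0) :
    brak q lam (1 + u 2 - u 1) / brak q lam 1 * ellE q lam 3 2 u v x a12 =
      (brak q lam (1 + u 2 - v 1) / brak q lam 1) *
        (brak q lam (1 + u 2 - v 2) / brak q lam 1) *
        (brak q lam (a12 + 2 - u 2 + v 3) / brak q lam (a12 + 2)) *
        (brak q lam (a12 + 1 - u 1 + v 1) / brak q lam (a12 + 1)) *
        (brak q lam (u 1 - v 2) * brak q lam (-a12 - 3) /
          (brak q lam 1 * brak q lam (-a12 - 2))) *
        (brak q lam (1 - u 1 + v 3) / brak q lam 1) +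
      (brak q lam (1 + u 2 - v 1) / brak q lam 1) *
        (brak q lam (a12 + 1 - u 2 + v 2) / brak q lam (a12 + 1)) *
        (brak q lam (u 2 - v 3) * brak q lam (-a12 - 3) /
          (brak q lam 1 * brak q lam (-a12 - 2))) *
        (brak q lam (a12 + 1 - u 1 + v 1) / brak q lam (a12 + 1)) *
        (brak q lam (-a12 - 2 - u 1 + v 2) / brak q lam (-a12 - 2)) *
        (brak q lam (a12 + 3 - u 1 + v 3) / brak q lam (a12 + 3)) +
      (brak q lam (a12 - u 2 + v 1) / brak q lam a12) *
        (brak q lam (u 2 - v 2) * brak q lam (-a12 - 2) /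
          (brak q lam 1 * brak q lam (-a12 - 1))) *
        (brak q lam (u 2 - v 3) * brak q lam (-a12 - 3) /
          (brak q lam 1 * brak q lam (-a12 - 2))) *
        (brak q lam (u 1 - v 1) * brak q lam a12 /
          (brak q lam 1 * brak q lam (a12 + 1))) *
        (brak q lam (1 + u 1 - v 2) / brak q lam 1) *
        (brak q lam (a12 + 3 - u 1 + v 3) / brak q lam (a12 + 3)) := by
  have B := three_term q hq0 hq1 lam
  have N := brak_neg q lam
  have E1 := B (a12 + 5 / 2 + (v 3 - u 2) / 2) ((1 - u 2 + v 3) / 2) ((1 + u 2 - v 3) / 2)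
    ((1 + u 2) / 2 - u 1 + v 3 / 2)
  have E2 := B (a12 + 3 / 2 + (u 1 - u 2) / 2) ((1 + u 1 - u 2) / 2) ((1 + u 1 + u 2) / 2 - v 2)
    ((1 + u 2 - u 1) / 2)
  have E3 := B (a12 + 1 + (v 1 - u 2) / 2) ((v 1 + u 2) / 2 - u 1) (1 + (u 2 - v 1) / 2)
    ((u 2 - v 1) / 2)
  have M := main_alg (brak q lam 1) (brak q lam a12) (brak q lam (a12 + 1)) (brak q lam (a12 + 2))
    (brak q lam (a12 + 3)) (brak q lam (1 + u 2 - u 1)) (brak q lam (u 1 - u 2))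
    (brak q lam (u 1 - v 3)) (brak q lam (a12 + 3 - u 2 + v 3)) (brak q lam (a12 + 2 - u 2 + v 3))
    (brak q lam (1 - u 1 + v 3)) (brak q lam (u 2 - v 3)) (brak q lam (a12 + 3 - u 1 + v 3))
    (brak q lam (a12 + 2 + u 1 - u 2))
    (brak q lam (1 + u 2 - v 2)) (brak q lam (u 1 - v 2)) (brak q lam (a12 + 1 - u 2 + v 2))
    (brak q lam (a12 + 2 + u 1 - v 2)) (brak q lam (u 2 - v 2)) (brak q lam (1 + u 1 - v 2))
    (brak q lam (a12 + 1 + u 1 - u 2))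
    (brak q lam (1 + u 2 - v 1)) (brak q lam (a12 + 1 - u 1 + v 1)) (brak q lam (a12 + 1 - u 2 + v 1))
    (brak q lam (1 + u 1 - v 1)) (brak q lam (a12 - u 2 + v 1)) (brak q lam (u 1 - v 1))
    hbr1 h0 h1 h2 h3 hu12
    (by
      have n1 := N (u 2 - v 3)
      ring_nf at E1 n1 ⊢
      rw [n1] at E1
      linear_combination E1)
    (by
      have n1 := N (u 2 - v 2)
      ring_nf at E2 n1 ⊢
      rw [n1] at E2
      linear_combination E2)
    (by
      have n1 := N (u 1 - u 2)
      have n2 := N (u 1 - v 1)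
      have n3 := N (1 + u 1 - v 1)
      ring_nf at E3 n1 n2 n3 ⊢
      rw [n1, n2, n3] at E3
      linear_combination E3)
  rw [← N (a12 + 1), ← N (a12 + 2), ← N (a12 + 3), ← N (u 1 - u 2), ← N (a12 + 2 + u 1 - v 2)] at M
  have g1 : -(a12 + 1) = -a12 - 1 := by ring
  have g2 : -(a12 + 2) = -a12 - 2 := by ring
  have g3 : -(a12 + 3) = -a12 - 3 := by ring
  have g4 : -(a12 + 2 + u 1 - v 2) = -a12 - 2 - u 1 + v 2 := by ring
  rw [g1, g2, g3, g4] at M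
  rw [← M]
  congr 1
  have i1 : Finset.Icc 2 3 = ({2, 3} : Finset ℕ) := by decide
  have i2 : Finset.Icc 1 2 = ({1, 2} : Finset ℕ) := by decide
  unfold ellE
  rw [univ_perm_two, Finset.sum_pair (by decide)]
  simp [xM, hx1, hx2, i1, i2, Fin.prod_univ_two]
  rw [show a12 + 1 + 2 = a12 + 3 by ring, show a12 + 3 - 1 = a12 + 2 by ring,
    show -u 1 + v 1 + a12 + 1 = a12 + 1 - u 1 + v 1 by ring,
    show -u 2 + v 3 + a12 + 3 = a12 + 3 - u 2 + v 3 by ring,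
    show -u 2 + v 1 + a12 + 1 = a12 + 1 - u 2 + v 1 by ring,
    show -u 1 + v 3 + a12 + 3 = a12 + 3 - u 1 + v 3 by ring]
  ring

end
end
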